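/- arXiv:0704.3894 — 3 statements merged into one kernel-verified Lean document; each statement's English description precedes it below -/
import Mathlib

section
/- Let V be an n-dimensional real vector space and let γ be an alternating k-form on V (with 1 ≤ k ≤ n). Then γ is multi-symplectic if and only if the rank of γ equals n. -/
noncomputable section

/-- The wedge product `f 0 ∧ ⋯ ∧ f (k-1)` of `k` covectors, as an alternating `k`-form:
`(v₁,…,v_k) ↦ det (f i (v j))`. -/
def covectorWedge {V : Type*} [AddCommGroup V] [Module ℝ V] {k : ℕ}
    (f : Fin k → Module.Dual ℝ V) : V [⋀^Fin k]→ₗ[ℝ] ℝ :=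
  (Matrix.detRowAlternating : (Fin k → ℝ) [⋀^Fin k]→ₗ[ℝ] ℝ).compLinearMap (LinearMap.pi f)

/-- The rank `ρ(γ)` of a `k`-form `γ`: the minimal dimension of a subspace `W ⊆ V*` such that
`γ` lies in the image of `Λ^k W`, i.e. in the span of wedge products of covectors from `W`. -/
def formRank {V : Type*} [AddCommGroup V] [Module ℝ V] {k : ℕ}
    (γ : V [⋀^Fin k]→ₗ[ℝ] ℝ) : ℕ :=
  sInf {d : ℕ | ∃ W : Submodule ℝ (Module.Dual ℝ V), Module.finrank ℝ W = d ∧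
    γ ∈ Submodule.span ℝ
      {φ : V [⋀^Fin k]→ₗ[ℝ] ℝ | ∃ f : Fin k → Module.Dual ℝ V,
        (∀ i, f i ∈ W) ∧ φ = covectorWedge f}}

/-- A `(k+1)`-form `γ` is multi-symplectic if the linear map
`I_γ : v ↦ v ⌟ γ` (insertion in the first slot) is injective. -/
def MultiSymplectic {V : Type*} [AddCommGroup V] [Module ℝ V] {k : ℕ}
    (γ : V [⋀^Fin (k + 1)]→ₗ[ℝ] ℝ) : Prop :=
  Function.Injective fun v => γ.curryLeft v

open Module

/-- An alternating form vanishes as soon as one argument lies in the kernel of its insertion map. -/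
theorem AlternatingMap.eq_zero_of_mem_ker_curryLeft {V : Type*} [AddCommGroup V] [Module ℝ V]
    {k : ℕ} (γ : V [⋀^Fin (k + 1)]→ₗ[ℝ] ℝ) (w : Fin (k + 1) → V) (i : Fin (k + 1))
    (hi : w i ∈ LinearMap.ker γ.curryLeft) : γ w = 0 := by
  have h0 : γ (w ∘ Equiv.swap 0 i) = 0 := by
    have := DFunLike.congr_fun (LinearMap.mem_ker.1 hi) (Matrix.vecTail (w ∘ Equiv.swap 0 i))
    rw [AlternatingMap.curryLeft_apply_apply] at this
    rw [← Matrix.cons_head_tail (w ∘ Equiv.swap 0 i)]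
    simpa [Matrix.vecHead] using this
  rw [AlternatingMap.map_perm] at h0
  exact (smul_eq_zero_iff_eq _).1 h0

/-- An alternating form does not change when its arguments are moved by elements of the kernel
of its insertion map. -/
theorem AlternatingMap.congr_of_sub_mem_ker_curryLeft {V : Type*} [AddCommGroup V] [Module ℝ V]
    {k : ℕ} (γ : V [⋀^Fin (k + 1)]→ₗ[ℝ] ℝ) (v w : Fin (k + 1) → V)
    (h : ∀ i, v i - w i ∈ LinearMap.ker γ.curryLeft) : γ v = γ w := by
  have hv : v = w + (v - w) := by abel
  have hsum := γ.toMultilinearMap.map_add_univ w (v - w)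
  rw [← hv] at hsum
  rw [Finset.sum_eq_single Finset.univ] at hsum
  · simpa using hsum
  · intro s _ hs
    obtain ⟨i, hi⟩ : ∃ i, i ∉ s := by
      by_contra! hall
      exact hs (Finset.eq_univ_iff_forall.2 hall)
    refine γ.eq_zero_of_mem_ker_curryLeft _ i ?_
    rw [Finset.piecewise_eq_of_notMem _ _ _ hi]
    exact h i
  · simp

theorem covectorWedge_apply {V : Type*} [AddCommGroup V] [Module ℝ V] {k : ℕ}
    (f : Fin k → Dual ℝ V) (v : Fin k → V) :
    covectorWedge f v = ∑ σ : Equiv.Perm (Fin k), Equiv.Perm.sign σ • ∏ i, f i (v (σ i)) := by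
  have : covectorWedge f v = (Matrix.of fun i j => f j (v i)).det := rfl
  rw [this, Matrix.det_apply]
  rfl

/-- A form that factors through `v ↦ ∑ j, c j v • u j` is a linear combination of wedges of the
covectors `c j`. -/
theorem mem_span_covectorWedge {V ι : Type*} [AddCommGroup V] [Module ℝ V] [Fintype ι] {k : ℕ}
    (γ : V [⋀^Fin k]→ₗ[ℝ] ℝ) (c : ι → Dual ℝ V) (u : ι → V)
    (h : ∀ v, γ v = γ fun i => ∑ j, c j (v i) • u j)
    (W : Submodule ℝ (Dual ℝ V)) (hc : ∀ j, c j ∈ W) :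
    γ ∈ Submodule.span ℝ {φ : V [⋀^Fin k]→ₗ[ℝ] ℝ |
      ∃ f : Fin k → Dual ℝ V, (∀ i, f i ∈ W) ∧ φ = covectorWedge f} := by
  classical
  have hexp : ∀ v, γ v = ∑ s : Fin k → ι, (∏ i, c (s i) (v i)) * γ fun i => u (s i) := by
    intro v
    rw [h v]
    refine (γ.toMultilinearMap.map_sum fun i j => c j (v i) • u j).trans ?_
    refine Finset.sum_congr rfl fun s _ => ?_
    exact γ.toMultilinearMap.map_smul_univ (fun i => c (s i) (v i)) fun i => u (s i)
  have key : (k.factorial : ℝ) • γ =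
      ∑ s : Fin k → ι, (γ fun i => u (s i)) • covectorWedge fun i => c (s i) := by
    ext v
    let evalAt : (V [⋀^Fin k]→ₗ[ℝ] ℝ) →+ ℝ := ⟨⟨fun φ => φ v, rfl⟩, fun _ _ => rfl⟩
    refine Eq.trans ?_ (map_sum evalAt _ _).symm
    simp only [evalAt, AddMonoidHom.coe_mk, ZeroHom.coe_mk, AlternatingMap.smul_apply,
      covectorWedge_apply, Finset.smul_sum]
    rw [Finset.sum_comm]
    have hσ : ∀ σ : Equiv.Perm (Fin k), (∑ s : Fin k → ι,
        (γ fun i => u (s i)) • Equiv.Perm.sign σ • ∏ i, c (s i) (v (σ i))) = γ v := by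
      intro σ
      have h1 : γ v = Equiv.Perm.sign σ • γ (v ∘ σ) := by
        rw [AlternatingMap.map_perm, smul_smul, Int.units_mul_self, one_smul]
      rw [h1, hexp, Finset.smul_sum]
      refine Finset.sum_congr rfl fun s _ => ?_
      rw [smul_comm, smul_eq_mul, mul_comm]
      rfl
    rw [Finset.sum_congr rfl fun σ _ => hσ σ]
    simp [Fintype.card_perm]
  have hk : (k.factorial : ℝ) ≠ 0 := by exact_mod_cast k.factorial_ne_zero
  rw [← inv_smul_smul₀ hk γ, key]
  refine Submodule.smul_mem _ _ (Submodule.sum_mem _ fun s _ => Submodule.smul_mem _ _ ?_)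
  exact Submodule.subset_span ⟨_, fun i => hc _, rfl⟩

/-- If `γ` is a combination of wedges of covectors from `W`, then every vector annihilated by `W`
is in the kernel of the insertion map. -/
theorem dualCoannihilator_le_ker_curryLeft {V : Type*} [AddCommGroup V] [Module ℝ V] {k : ℕ}
    (γ : V [⋀^Fin (k + 1)]→ₗ[ℝ] ℝ) (W : Submodule ℝ (Dual ℝ V))
    (h : γ ∈ Submodule.span ℝ {φ : V [⋀^Fin (k + 1)]→ₗ[ℝ] ℝ |
      ∃ f : Fin (k + 1) → Dual ℝ V, (∀ i, f i ∈ W) ∧ φ = covectorWedge f}) :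
    W.dualCoannihilator ≤ LinearMap.ker γ.curryLeft := by
  intro x hx
  rw [Submodule.mem_dualCoannihilator] at hx
  rw [LinearMap.mem_ker]
  induction h using Submodule.span_induction with
  | mem φ hφ =>
    obtain ⟨f, hf, rfl⟩ := hφ
    ext v
    have : (covectorWedge f).curryLeft x v =
        (Matrix.of fun i j => f j (Matrix.vecCons x v i)).det := rfl
    rw [this]
    exact Matrix.det_eq_zero_of_row_eq_zero 0 fun j => hx _ (hf j)
  | zero => rfl
  | add φ ψ _ _ hφ hψ => rw [AlternatingMap.curryLeft_add, LinearMap.add_apply, hφ, hψ, add_zero]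
  | smul a φ _ hφ => rw [AlternatingMap.curryLeft_smul, LinearMap.smul_apply, hφ, smul_zero]

/-- The rank of a form is the codimension of the kernel of its insertion map. -/
theorem formRank_add_finrank_ker_curryLeft {V : Type*} [AddCommGroup V] [Module ℝ V]
    [FiniteDimensional ℝ V] {k : ℕ} (γ : V [⋀^Fin (k + 1)]→ₗ[ℝ] ℝ) :
    formRank γ + finrank ℝ (LinearMap.ker γ.curryLeft) = finrank ℝ V := by
  obtain ⟨U, hU⟩ := Submodule.exists_isCompl (LinearMap.ker γ.curryLeft)
  let P := U.projectionOnto _ hU.symm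
  let b := finBasis ℝ U
  let c : Fin (finrank ℝ U) → Dual ℝ V := fun j => b.coord j ∘ₗ P
  have hP : ∀ v, ∑ j, c j v • (b j : V) = P v := by
    intro v
    have := congrArg Subtype.val (b.sum_repr (P v))
    rw [← this, AddSubmonoidClass.coe_finsetSum]
    rfl
  have hmem := mem_span_covectorWedge γ c (fun j => (b j : V)) (by
      intro v
      refine γ.congr_of_sub_mem_ker_curryLeft _ _ fun i => ?_
      rw [hP]
      rw [← Submodule.projectionOnto_apply_eq_zero_iff hU.symm, map_sub,
        Submodule.projectionOnto_apply_left, sub_self])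
    (Submodule.span ℝ (Set.range c)) fun j => Submodule.subset_span ⟨j, rfl⟩
  have hle : formRank γ ≤ finrank ℝ (Submodule.span ℝ (Set.range c)) :=
    Nat.sInf_le ⟨_, rfl, hmem⟩
  have hcard : finrank ℝ (Submodule.span ℝ (Set.range c)) ≤ finrank ℝ U :=
    (finrank_range_le_card c).trans (by simp)
  have hsum := Submodule.finrank_add_eq_of_isCompl hU
  obtain ⟨W, hW, hγ⟩ : formRank γ ∈ {d : ℕ | ∃ W : Submodule ℝ (Dual ℝ V), finrank ℝ W = d ∧
      γ ∈ Submodule.span ℝ {φ : V [⋀^Fin (k + 1)]→ₗ[ℝ] ℝ |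
        ∃ f : Fin (k + 1) → Dual ℝ V, (∀ i, f i ∈ W) ∧ φ = covectorWedge f}} :=
    Nat.sInf_mem ⟨_, _, rfl, hmem⟩
  have hker := Submodule.finrank_mono (dualCoannihilator_le_ker_curryLeft γ W hγ)
  have hdim := Subspace.finrank_add_finrank_dualCoannihilator_eq W
  omega

/-- A `(k+1)`-form on an `n`-dimensional real vector space (with `k+1 ≤ n`) is
multi-symplectic iff its rank equals `n`. -/
theorem multisymplectic_iff_formRank_eq {V : Type*} [AddCommGroup V] [Module ℝ V]
    [FiniteDimensional ℝ V] {n k : ℕ} (hn : Module.finrank ℝ V = n) (hk : k + 1 ≤ n)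
    (γ : V [⋀^Fin (k + 1)]→ₗ[ℝ] ℝ) :
    MultiSymplectic γ ↔ formRank γ = n := by
  have h := formRank_add_finrank_ker_curryLeft γ
  have hinj : MultiSymplectic γ ↔ finrank ℝ (LinearMap.ker γ.curryLeft) = 0 := by
    rw [Submodule.finrank_eq_zero, LinearMap.ker_eq_bot]
    rfl
  rw [hinj]
  omega
end
end

section
/- Every stable 3-form γ on ℝ^6 is equivalent to exactly one of the forms γ_1 = e^{123} + e^{456} or γ_2 = e^{135} − e^{146} − e^{236} − e^{245} (the real part of (e^1+ie^2)∧(e^3+ie^4)∧(e^5+ie^6)); that is, there exists g ∈ GL(6,ℝ) with g^*γ equal to γ_1 or γ_2. -/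
noncomputable section

/-- The natural topology on the finite-dimensional space of alternating `k`-forms on `ℝⁿ`
(the topology induced by evaluation; it coincides with the standard vector space topology). -/
instance altFormTopology (n k : ℕ) :
    TopologicalSpace ((Fin n → ℝ) [⋀^Fin k]→ₗ[ℝ] ℝ) :=
  TopologicalSpace.induced (fun φ => (⇑φ : (Fin k → Fin n → ℝ) → ℝ)) inferInstance

/-- The pullback `g^*γ` of a `k`-form on `ℝⁿ` by a linear map `g`:
`(g^*γ)(v₁,…,v_k) = γ (g v₁, …, g v_k)`. -/
def formPullback {n k : ℕ} (g : (Fin n → ℝ) →ₗ[ℝ] (Fin n → ℝ))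
    (γ : (Fin n → ℝ) [⋀^Fin k]→ₗ[ℝ] ℝ) : (Fin n → ℝ) [⋀^Fin k]→ₗ[ℝ] ℝ :=
  γ.compLinearMap g

/-- A `k`-form on `ℝⁿ` is stable if its `GL(n,ℝ)`-orbit (under pullback) is open in the
space of all alternating `k`-forms. -/
def IsStableForm {n k : ℕ} (γ : (Fin n → ℝ) [⋀^Fin k]→ₗ[ℝ] ℝ) : Prop :=
  IsOpen {φ : (Fin n → ℝ) [⋀^Fin k]→ₗ[ℝ] ℝ |
    ∃ g : (Fin n → ℝ) ≃ₗ[ℝ] (Fin n → ℝ), φ = formPullback g.toLinearMap γ}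

/-- `e^i ∧ e^j ∧ e^k` on `ℝⁿ`, where `e^1,…,e^n` is the dual of the standard basis
(here indexed from `0`, so the paper's `e^{pqr}` is `eee (p-1) (q-1) (r-1)`). -/
def eee {n : ℕ} (i j k : Fin n) : (Fin n → ℝ) [⋀^Fin 3]→ₗ[ℝ] ℝ :=
  covectorWedge ![LinearMap.proj i, LinearMap.proj j, LinearMap.proj k]

/-- The form `γ₁ = e^{123} + e^{456}` on `ℝ⁶`. -/
def gammaOne : (Fin 6 → ℝ) [⋀^Fin 3]→ₗ[ℝ] ℝ := eee 0 1 2 + eee 3 4 5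

/-- The form `γ₂ = e^{135} - e^{146} - e^{236} - e^{245}`, the real part of
`(e^1+ie^2)∧(e^3+ie^4)∧(e^5+ie^6)`, on `ℝ⁶`. -/
def gammaTwo : (Fin 6 → ℝ) [⋀^Fin 3]→ₗ[ℝ] ℝ := eee 0 2 4 - eee 0 3 5 - eee 1 2 5 - eee 1 3 4

theorem eee_apply {n : ℕ} (i j k : Fin n) (x y z : Fin n → ℝ) :
    eee i j k ![x, y, z] =
      x i * y j * z k - x i * y k * z j - x j * y i * z k + x j * y k * z i
        + x k * y i * z j - x k * y j * z i := by
  change Matrix.det (Matrix.of fun r c : Fin 3 =>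
    (![LinearMap.proj i, LinearMap.proj j, LinearMap.proj k] :
      Fin 3 → Module.Dual ℝ (Fin n → ℝ)) c (![x, y, z] r)) = _
  rw [Matrix.det_fin_three]
  simp only [Matrix.of_apply, Matrix.cons_val, LinearMap.proj_apply]

section Trilinear

variable {V : Type*} [AddCommGroup V] [Module ℝ V] (φ : V [⋀^Fin 3]→ₗ[ℝ] ℝ)

theorem update_vec_fst {α : Type*} (x y z w : α) :
    Function.update ![x, y, z] 0 w = ![w, y, z] := by
  ext i; fin_cases i <;> rfl

theorem map_add_fst (x y z w : V) :
    φ ![x + w, y, z] = φ ![x, y, z] + φ ![w, y, z] := by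
  have := φ.map_update_add ![x, y, z] 0 x w
  rwa [update_vec_fst, update_vec_fst, update_vec_fst] at this

theorem map_smul_fst (c : ℝ) (x y z : V) :
    φ ![c • x, y, z] = c * φ ![x, y, z] := by
  have := φ.map_update_smul ![x, y, z] 0 c x
  rwa [update_vec_fst, update_vec_fst, smul_eq_mul] at this

theorem update_vec_snd {α : Type*} (x y z w : α) :
    Function.update ![x, y, z] 1 w = ![x, w, z] := by
  ext i; fin_cases i <;> rfl

theorem map_add_snd (x y z w : V) :
    φ ![x, y + w, z] = φ ![x, y, z] + φ ![x, w, z] := by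
  have := φ.map_update_add ![x, y, z] 1 y w
  rwa [update_vec_snd, update_vec_snd, update_vec_snd] at this

theorem map_smul_snd (c : ℝ) (x y z : V) :
    φ ![x, c • y, z] = c * φ ![x, y, z] := by
  have := φ.map_update_smul ![x, y, z] 1 c y
  rwa [update_vec_snd, update_vec_snd, smul_eq_mul] at this

theorem update_vec_trd {α : Type*} (x y z w : α) :
    Function.update ![x, y, z] 2 w = ![x, y, w] := by
  ext i; fin_cases i <;> rfl

theorem map_add_trd (x y z w : V) :
    φ ![x, y, z + w] = φ ![x, y, z] + φ ![x, y, w] := by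
  have := φ.map_update_add ![x, y, z] 2 z w
  rwa [update_vec_trd, update_vec_trd, update_vec_trd] at this

theorem map_smul_trd (c : ℝ) (x y z : V) :
    φ ![x, y, c • z] = c * φ ![x, y, z] := by
  have := φ.map_update_smul ![x, y, z] 2 c z
  rwa [update_vec_trd, update_vec_trd, smul_eq_mul] at this

theorem map_swap_fst_snd (x y z : V) : φ ![y, x, z] = -φ ![x, y, z] := by
  rw [← φ.map_swap ![x, y, z] (show (0 : Fin 3) ≠ 1 by decide)]
  congr 1; ext i; fin_cases i <;> rfl

theorem map_swap_snd_trd (x y z : V) : φ ![x, z, y] = -φ ![x, y, z] := by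
  rw [← φ.map_swap ![x, y, z] (show (1 : Fin 3) ≠ 2 by decide)]
  congr 1; ext i; fin_cases i <;> rfl

theorem map_self_fst_snd (x y : V) : φ ![x, x, y] = 0 :=
  φ.map_eq_zero_of_eq ![x, x, y] (i := 0) (j := 1) rfl (by decide)

theorem map_self_fst_trd (x y : V) : φ ![x, y, x] = 0 :=
  φ.map_eq_zero_of_eq ![x, y, x] (i := 0) (j := 2) rfl (by decide)

theorem map_self_snd_trd (x y : V) : φ ![y, x, x] = 0 :=
  φ.map_eq_zero_of_eq ![y, x, x] (i := 1) (j := 2) rfl (by decide)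

end Trilinear

theorem ext_of_lt {n : ℕ} {φ ψ : (Fin n → ℝ) [⋀^Fin 3]→ₗ[ℝ] ℝ}
    (h : ∀ i j k : Fin n, i < j → j < k →
      φ ![Pi.single i 1, Pi.single j 1, Pi.single k 1] =
        ψ ![Pi.single i 1, Pi.single j 1, Pi.single k 1]) : φ = ψ := by
  refine Module.Basis.ext_alternating (Pi.basisFun ℝ (Fin n)) fun v hv => ?_
  have hm : StrictMono (v ∘ Tuple.sort v) :=
    (Tuple.monotone_sort v).strictMono_of_injective (hv.comp (Tuple.sort v).injective)
  have key := h _ _ _ (hm (show (0 : Fin 3) < 1 by decide)) (hm (show (1 : Fin 3) < 2 by decide))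
  have e : (![Pi.single ((v ∘ Tuple.sort v) 0) 1, Pi.single ((v ∘ Tuple.sort v) 1) 1,
      Pi.single ((v ∘ Tuple.sort v) 2) 1] : Fin 3 → Fin n → ℝ)
      = (fun i => Pi.basisFun ℝ (Fin n) (v i)) ∘ Tuple.sort v := by
    funext i; fin_cases i <;> simp
  rw [e, φ.map_perm, ψ.map_perm] at key
  simpa using key

theorem formPullback_apply {n : ℕ} (g : (Fin n → ℝ) →ₗ[ℝ] (Fin n → ℝ))
    (φ : (Fin n → ℝ) [⋀^Fin 3]→ₗ[ℝ] ℝ) (x y z : Fin n → ℝ) :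
    formPullback g φ ![x, y, z] = φ ![g x, g y, g z] := by
  rw [formPullback, AlternatingMap.compLinearMap_apply]
  congr 1; ext i; fin_cases i <;> rfl

theorem formPullback_formPullback {n k : ℕ} (g h : (Fin n → ℝ) →ₗ[ℝ] (Fin n → ℝ))
    (φ : (Fin n → ℝ) [⋀^Fin k]→ₗ[ℝ] ℝ) :
    formPullback h (formPullback g φ) = formPullback (g ∘ₗ h) φ := rfl

theorem IsStableForm.pullback {n k : ℕ} {φ : (Fin n → ℝ) [⋀^Fin k]→ₗ[ℝ] ℝ}
    (hφ : IsStableForm φ) (g : (Fin n → ℝ) ≃ₗ[ℝ] (Fin n → ℝ)) :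
    IsStableForm (formPullback g.toLinearMap φ) := by
  unfold IsStableForm at *
  convert hφ using 1
  ext ψ
  constructor
  · rintro ⟨h, rfl⟩
    exact ⟨h.trans g, rfl⟩
  · rintro ⟨h, rfl⟩
    refine ⟨h.trans g.symm, ?_⟩
    rw [formPullback_formPullback]
    congr 1
    ext; simp

theorem IsStableForm.exists_add_smul {n k : ℕ} {φ : (Fin n → ℝ) [⋀^Fin k]→ₗ[ℝ] ℝ}
    (hφ : IsStableForm φ) (η : (Fin n → ℝ) [⋀^Fin k]→ₗ[ℝ] ℝ) {S : Set ℝ} (hS : S.Finite) :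
    ∃ t ∉ S, ∃ g : (Fin n → ℝ) ≃ₗ[ℝ] (Fin n → ℝ),
      formPullback g.toLinearMap φ = φ + t • η := by
  have hc : Continuous fun t : ℝ => φ + t • η := by
    refine continuous_induced_rng.2 (continuous_pi fun v => ?_)
    simp only [Function.comp_apply, AlternatingMap.add_apply, AlternatingMap.smul_apply]
    fun_prop
  have h0 := (hφ.preimage hc).mem_nhds (x := (0 : ℝ))
    ⟨LinearEquiv.refl ℝ _, by ext; simp [formPullback]⟩
  have h1 : Sᶜ ∈ nhdsWithin (0 : ℝ) {0}ᶜ := nhdsNE_le_cofinite 0 hS.compl_mem_cofinite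
  obtain ⟨t, ⟨g, hg⟩, ht⟩ := Filter.nonempty_of_mem
    (Filter.inter_mem (mem_nhdsWithin_of_mem_nhds h0) h1)
  exact ⟨t, ht, g, hg.symm⟩

theorem not_equiv_gammaOne_gammaTwo (g : (Fin 6 → ℝ) ≃ₗ[ℝ] (Fin 6 → ℝ)) :
    formPullback g.toLinearMap gammaTwo ≠ gammaOne := by
  intro h
  obtain ⟨v, hv0, hv⟩ : ∃ v : Fin 6 → ℝ, v ≠ 0 ∧ ∀ a b c d,
      gammaTwo ![v, a, b] * gammaTwo ![v, c, d] - gammaTwo ![v, a, c] * gammaTwo ![v, b, d]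
        + gammaTwo ![v, a, d] * gammaTwo ![v, b, c] = 0 := by
    refine ⟨g (Pi.single 0 1), by simp, fun a b c d => ?_⟩
    have key (x y) : gammaTwo ![g (Pi.single 0 1), x, y] =
        gammaOne ![Pi.single 0 1, g.symm x, g.symm y] := by
      rw [← h, formPullback_apply]; simp
    simp only [key, gammaOne, AlternatingMap.add_apply, eee_apply]
    simp
    ring
  have h1 := hv (Pi.single 2 1) (Pi.single 3 1) (Pi.single 4 1) (Pi.single 5 1)
  have h2 := hv (Pi.single 0 1) (Pi.single 1 1) (Pi.single 4 1) (Pi.single 5 1)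
  have h3 := hv (Pi.single 0 1) (Pi.single 1 1) (Pi.single 2 1) (Pi.single 3 1)
  simp [gammaTwo, AlternatingMap.sub_apply, eee_apply] at h1 h2 h3
  apply hv0
  ext i
  fin_cases i <;> simp <;> nlinarith

theorem gammaOne_nondegenerate (x : Fin 6 → ℝ) (h : ∀ y z, gammaOne ![x, y, z] = 0) : x = 0 := by
  have h0 := h (Pi.single 1 1) (Pi.single 2 1)
  have h1 := h (Pi.single 0 1) (Pi.single 2 1)
  have h2 := h (Pi.single 0 1) (Pi.single 1 1)
  have h3 := h (Pi.single 4 1) (Pi.single 5 1)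
  have h4 := h (Pi.single 3 1) (Pi.single 5 1)
  have h5 := h (Pi.single 3 1) (Pi.single 4 1)
  simp [gammaOne, eee_apply] at h0 h1 h2 h3 h4 h5
  ext i
  fin_cases i <;> simpa

theorem gammaTwo_nondegenerate (x : Fin 6 → ℝ) (h : ∀ y z, gammaTwo ![x, y, z] = 0) : x = 0 := by
  have h0 := h (Pi.single 2 1) (Pi.single 4 1)
  have h1 := h (Pi.single 2 1) (Pi.single 5 1)
  have h2 := h (Pi.single 0 1) (Pi.single 4 1)
  have h3 := h (Pi.single 0 1) (Pi.single 5 1)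
  have h4 := h (Pi.single 0 1) (Pi.single 2 1)
  have h5 := h (Pi.single 1 1) (Pi.single 2 1)
  simp [gammaTwo, eee_apply] at h0 h1 h2 h3 h4 h5
  ext i
  fin_cases i <;> simpa

theorem exists_equiv_of_nondegenerate {n : ℕ} {φ ψ : (Fin n → ℝ) [⋀^Fin 3]→ₗ[ℝ] ℝ}
    (hψ : ∀ x, (∀ y z, ψ ![x, y, z] = 0) → x = 0) {g : (Fin n → ℝ) →ₗ[ℝ] (Fin n → ℝ)}
    (hg : formPullback g φ = ψ) :
    ∃ g : (Fin n → ℝ) ≃ₗ[ℝ] (Fin n → ℝ), formPullback g.toLinearMap φ = ψ := by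
  have hinj : Function.Injective g := by
    refine (injective_iff_map_eq_zero g).2 fun x hx => hψ x fun y z => ?_
    rw [← hg, formPullback_apply, hx]
    exact φ.map_coord_zero 0 rfl
  exact ⟨LinearEquiv.ofInjectiveEndo g hinj, hg⟩

/-- The polarization of the binary cubic `a x³ + 3 x y² + b y³`. -/
def polarCubic {K : Type*} [CommRing K] (a b : K) (p q r : K × K) : K :=
  a * (p.1 * q.1 * r.1) + (p.1 * q.2 * r.2 + p.2 * q.1 * r.2 + p.2 * q.2 * r.1)
    + b * (p.2 * q.2 * r.2)

theorem polarCubic_self_ne_zero {K : Type*} [Field K] {a b s s' : K} (ha : a ≠ 0)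
    (hadd : s + s' = a * b) (hmul : s * s' = -a) (hs : s ≠ s') :
    polarCubic a b (1, s) (1, s) (1, s) ≠ 0 := by
  have hs0 : s ≠ 0 := by
    rintro rfl
    exact ha (by linear_combination hmul)
  have hC : polarCubic a b (1, s) (1, s) (1, s) = (s - s') * (s * (2 + b * s)) := by
    simp only [polarCubic]
    linear_combination s * hadd + (1 + b * s) * hmul
  rw [hC]
  refine mul_ne_zero (sub_ne_zero.2 hs) (mul_ne_zero hs0 fun h => ?_)
  refine mul_ne_zero hs0 (sub_ne_zero.2 hs) ?_
  linear_combination s * hadd - 2 * hmul + a * h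

theorem polarCubic_mixed_eq_zero {K : Type*} [CommRing K] {a b s s' : K}
    (hadd : s + s' = a * b) (hmul : s * s' = -a) (c c' : K) :
    polarCubic a b (c, c * s) (c, c * s) (c', c' * s') = 0 := by
  simp only [polarCubic]
  linear_combination c ^ 2 * c' * (s * hadd + (1 + b * s) * hmul)

theorem exists_real_cube_eq (x : ℝ) : ∃ c : ℝ, c ^ 3 = x := by
  rcases le_total 0 x with h | h
  · exact ⟨x ^ ((3 : ℕ) : ℝ)⁻¹, Real.rpow_inv_natCast_pow h (by decide)⟩
  · refine ⟨-(-x) ^ ((3 : ℕ) : ℝ)⁻¹, ?_⟩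
    rw [Odd.neg_pow (by decide), Real.rpow_inv_natCast_pow (neg_nonneg.2 h) (by decide), neg_neg]

theorem polarCubic_normal_form_pos {a b : ℝ} (hD : 0 < a * (a * b ^ 2 + 4)) :
    ∃ p q : ℝ × ℝ, polarCubic a b p p p = 1 ∧ polarCubic a b p p q = 0 ∧
      polarCubic a b p q q = 0 ∧ polarCubic a b q q q = 1 := by
  have ha : a ≠ 0 := left_ne_zero_of_mul hD.ne'
  obtain ⟨s, s', h1, h2, hs⟩ : ∃ s s' : ℝ, s + s' = a * b ∧ s * s' = -a ∧ s ≠ s' := by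
    have hd := Real.sq_sqrt hD.le
    have hd0 := Real.sqrt_pos.2 hD
    refine ⟨(a * b + √(a * (a * b ^ 2 + 4))) / 2, (a * b - √(a * (a * b ^ 2 + 4))) / 2,
      by ring, by linear_combination -hd / 4, fun h => ?_⟩
    linarith
  have hself (s s' : ℝ) (h1 : s + s' = a * b) (h2 : s * s' = -a) (hs : s ≠ s') :
      ∃ c : ℝ, polarCubic a b (c, c * s) (c, c * s) (c, c * s) = 1 := by
    have hC := polarCubic_self_ne_zero ha h1 h2 hs
    obtain ⟨c, hc⟩ := exists_real_cube_eq (polarCubic a b (1, s) (1, s) (1, s))⁻¹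
    refine ⟨c, ?_⟩
    rw [← inv_mul_cancel₀ hC, ← hc]
    simp only [polarCubic]
    ring
  rw [add_comm] at h1
  rw [mul_comm] at h2
  obtain ⟨c', hc'⟩ := hself s' s h1 h2 hs.symm
  have hm' := polarCubic_mixed_eq_zero h1 h2 c'
  rw [add_comm] at h1
  rw [mul_comm] at h2
  obtain ⟨c, hc⟩ := hself s s' h1 h2 hs
  refine ⟨(c, c * s), (c', c' * s'), hc, polarCubic_mixed_eq_zero h1 h2 c c', ?_, hc'⟩
  rw [← hm' c]
  simp only [polarCubic]
  ring

theorem polarCubic_normal_form_neg {a b : ℝ} (hD : a * (a * b ^ 2 + 4) < 0) :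
    ∃ p q : ℝ × ℝ, polarCubic a b p p p = 1 ∧ polarCubic a b p p q = 0 ∧
      polarCubic a b p q q = -1 ∧ polarCubic a b q q q = 0 := by
  have ha : (a : ℂ) ≠ 0 := Complex.ofReal_ne_zero.2 (left_ne_zero_of_mul hD.ne)
  obtain ⟨s, h1, h2, hs⟩ : ∃ s : ℂ, s + star s = a * b ∧ s * star s = -a ∧ s ≠ star s := by
    have hd := Real.sq_sqrt (neg_nonneg.2 hD.le)
    have hd0 := Real.sqrt_pos.2 (neg_pos.2 hD)
    refine ⟨⟨a * b / 2, √(-(a * (a * b ^ 2 + 4))) / 2⟩, ?_, ?_, fun h => ?_⟩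
    · apply Complex.ext <;> simp
    · apply Complex.ext <;> simp
      · linear_combination hd / 4
      · ring
    · have := congrArg Complex.im h
      simp at this
      linarith
  have hC := polarCubic_self_ne_zero ha h1 h2 hs
  obtain ⟨c, hc⟩ := IsAlgClosed.exists_pow_nat_eq
    (4 * (polarCubic (a : ℂ) b (1, s) (1, s) (1, s))⁻¹) (show 0 < 3 by decide)
  have hself : polarCubic (a : ℂ) b (c, c * s) (c, c * s) (c, c * s) = 4 := by
    have : polarCubic (a : ℂ) b (c, c * s) (c, c * s) (c, c * s)
        = c ^ 3 * polarCubic (a : ℂ) b (1, s) (1, s) (1, s) := by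
      simp only [polarCubic]
      ring
    rw [this, hc, mul_assoc, inv_mul_cancel₀ hC, mul_one]
  have hmix := polarCubic_mixed_eq_zero h1 h2 c (star c)
  rw [← star_mul'] at hmix
  generalize c * s = d at hself hmix
  have e1 := congrArg Complex.re hself
  have e2 := congrArg Complex.im hself
  have e3 := congrArg Complex.re hmix
  have e4 := congrArg Complex.im hmix
  simp [polarCubic] at e1 e2 e3 e4
  refine ⟨(c.re, d.re), (c.im, d.im), ?_, ?_, ?_, ?_⟩ <;> simp only [polarCubic]
  · linear_combination (e1 + 3 * e3) / 4
  · linear_combination (e2 + e4) / 4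
  · linear_combination (e3 - e1) / 4
  · linear_combination (3 * e4 - e2) / 4

/-- The 3-form on `ℝ⁶ = ℝ² ⊗ ℝ³` attached to the binary cubic `p x³ + 3 q x² y + 3 r x y² + s y³`. -/
def cubicForm (p q r s : ℝ) : (Fin 6 → ℝ) [⋀^Fin 3]→ₗ[ℝ] ℝ :=
  p • eee 0 1 2 + q • (eee 1 2 3 + eee 2 0 4 + eee 0 1 5)
    + r • (eee 0 4 5 + eee 1 5 3 + eee 2 3 4) + s • eee 3 4 5

theorem forall_lt_lt_fin_six {P : Fin 6 → Fin 6 → Fin 6 → Prop}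
    (h : P 0 1 2 ∧ P 0 1 3 ∧ P 0 1 4 ∧ P 0 1 5 ∧ P 0 2 3 ∧ P 0 2 4 ∧ P 0 2 5 ∧ P 0 3 4 ∧ P 0 3 5 ∧
      P 0 4 5 ∧ P 1 2 3 ∧ P 1 2 4 ∧ P 1 2 5 ∧ P 1 3 4 ∧ P 1 3 5 ∧ P 1 4 5 ∧ P 2 3 4 ∧ P 2 3 5 ∧
      P 2 4 5 ∧ P 3 4 5) (i j k : Fin 6) (hij : i < j) (hjk : j < k) : P i j k := by
  fin_cases i <;> fin_cases j <;> try exact absurd hij (by decide)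
  all_goals fin_cases k <;> first | exact absurd hjk (by decide) | tauto

theorem formPullback_cubicForm (a b : ℝ) (p q : ℝ × ℝ) :
    formPullback (Fintype.linearCombination ℝ
      ![![p.1, 0, 0, p.2, 0, 0], ![0, p.1, 0, 0, p.2, 0], ![0, 0, p.1, 0, 0, p.2],
        ![q.1, 0, 0, q.2, 0, 0], ![0, q.1, 0, 0, q.2, 0], ![0, 0, q.1, 0, 0, q.2]])
      (cubicForm a 0 1 b) =
    cubicForm (polarCubic a b p p p) (polarCubic a b p p q) (polarCubic a b p q q)
      (polarCubic a b q q q) := by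
  refine ext_of_lt (forall_lt_lt_fin_six ?_)
  simp only [formPullback_apply, Fintype.linearCombination_apply_single, cubicForm, polarCubic,
    AlternatingMap.add_apply, AlternatingMap.smul_apply, eee_apply]
  refine ⟨?_, ?_, ?_, ?_, ?_, ?_, ?_, ?_, ?_, ?_, ?_, ?_, ?_, ?_, ?_, ?_, ?_, ?_, ?_, ?_⟩ <;>
    simp <;> try ring

theorem formPullback_cubicForm_eq_gammaTwo :
    formPullback (LinearMap.funLeft ℝ ℝ (![0, 2, 4, 1, 3, 5] : Fin 6 → Fin 6))
      (cubicForm 1 0 (-1) 0) = gammaTwo := by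
  refine ext_of_lt (forall_lt_lt_fin_six ?_)
  simp only [formPullback_apply, cubicForm, gammaTwo,
    AlternatingMap.add_apply, AlternatingMap.sub_apply, AlternatingMap.smul_apply, eee_apply]
  simp [LinearMap.funLeft_apply]

theorem cubicForm_nondegenerate (a b : ℝ) (x : Fin 6 → ℝ)
    (h : ∀ y z, cubicForm a 0 1 b ![x, y, z] = 0) : x = 0 := by
  have h3 := h (Pi.single 1 1) (Pi.single 5 1)
  have h4 := h (Pi.single 2 1) (Pi.single 3 1)
  have h5 := h (Pi.single 0 1) (Pi.single 4 1)
  have h0 := h (Pi.single 4 1) (Pi.single 5 1)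
  have h1 := h (Pi.single 5 1) (Pi.single 3 1)
  have h2 := h (Pi.single 3 1) (Pi.single 4 1)
  simp [cubicForm, eee_apply] at h0 h1 h2 h3 h4 h5
  simp [h3, h4, h5] at h0 h1 h2
  ext i
  fin_cases i <;> simpa

/-- A 3-form is equivalent to one of the two model forms. -/
def IsModelForm (φ : (Fin 6 → ℝ) [⋀^Fin 3]→ₗ[ℝ] ℝ) : Prop :=
  (∃ g : (Fin 6 → ℝ) ≃ₗ[ℝ] (Fin 6 → ℝ), formPullback g.toLinearMap φ = gammaOne) ∨
    ∃ g : (Fin 6 → ℝ) ≃ₗ[ℝ] (Fin 6 → ℝ), formPullback g.toLinearMap φ = gammaTwo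

theorem IsModelForm.of_pullback {φ : (Fin 6 → ℝ) [⋀^Fin 3]→ₗ[ℝ] ℝ}
    (g : (Fin 6 → ℝ) ≃ₗ[ℝ] (Fin 6 → ℝ)) (h : IsModelForm (formPullback g.toLinearMap φ)) :
    IsModelForm φ :=
  h.imp (fun ⟨k, hk⟩ => ⟨k.trans g, hk⟩) (fun ⟨k, hk⟩ => ⟨k.trans g, hk⟩)

theorem isModelForm_cubicForm {a b : ℝ} (hD : a * (a * b ^ 2 + 4) ≠ 0) :
    IsModelForm (cubicForm a 0 1 b) := by
  rcases hD.lt_or_gt with hD | hD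
  · obtain ⟨p, q, h1, h2, h3, h4⟩ := polarCubic_normal_form_neg hD
    obtain ⟨g, hg⟩ : ∃ g, formPullback g (cubicForm a 0 1 b) = cubicForm 1 0 (-1) 0 :=
      ⟨_, by rw [formPullback_cubicForm a b p q, h1, h2, h3, h4]⟩
    refine Or.inr (exists_equiv_of_nondegenerate gammaTwo_nondegenerate
      (g := g ∘ₗ LinearMap.funLeft ℝ ℝ (![0, 2, 4, 1, 3, 5] : Fin 6 → Fin 6)) ?_)
    rw [← formPullback_formPullback, hg, formPullback_cubicForm_eq_gammaTwo]
  · obtain ⟨p, q, h1, h2, h3, h4⟩ := polarCubic_normal_form_pos hD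
    have h := formPullback_cubicForm a b p q
    rw [h1, h2, h3, h4] at h
    refine Or.inl (exists_equiv_of_nondegenerate gammaOne_nondegenerate (h.trans ?_))
    simp [cubicForm, gammaOne]

theorem IsModelForm.of_cubicForm {a b : ℝ} (h : IsStableForm (cubicForm a 0 1 b)) :
    IsModelForm (cubicForm a 0 1 b) := by
  obtain ⟨t, ht, g, hg⟩ := h.exists_add_smul (eee 0 1 2) (Set.toFinite {-a, -4 / b ^ 2 - a})
  have hsum : cubicForm a 0 1 b + t • eee 0 1 2 = cubicForm (a + t) 0 1 b := by
    simp only [cubicForm, add_smul]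
    abel
  refine .of_pullback g ?_
  rw [hg, hsum]
  refine isModelForm_cubicForm (mul_ne_zero (fun h0 => ?_) (fun h0 => ?_))
  · exact ht (Or.inl (by linarith))
  · have hb : b ≠ 0 := by
      rintro rfl
      norm_num at h0
    refine ht (Or.inr ?_)
    rw [Set.mem_singleton_iff]
    field_simp
    linear_combination h0

theorem exists_pullback_eq_cubicForm {φ : (Fin 6 → ℝ) [⋀^Fin 3]→ₗ[ℝ] ℝ}
    {N : Matrix (Fin 3) (Fin 3) ℝ}
    (hmix : ∀ i j k : Fin 6, i < 3 → j < 3 → 3 ≤ k →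
      φ ![Pi.single i 1, Pi.single j 1, Pi.single k 1] = 0)
    (hN : ∀ i : Fin 3, N i = ![φ ![Pi.single (i.castAdd 3) 1, Pi.single 4 1, Pi.single 5 1],
      φ ![Pi.single (i.castAdd 3) 1, Pi.single 5 1, Pi.single 3 1],
      φ ![Pi.single (i.castAdd 3) 1, Pi.single 3 1, Pi.single 4 1]])
    (hdet : N.det ≠ 0) :
    ∃ (g : (Fin 6 → ℝ) ≃ₗ[ℝ] (Fin 6 → ℝ)) (a b : ℝ),
      formPullback g.toLinearMap φ = cubicForm a 0 1 b := by
  have hinv : N⁻¹ * N = 1 := Matrix.nonsing_inv_mul N (isUnit_iff_ne_zero.2 hdet)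
  generalize N⁻¹ = B at hinv
  have hBN (i l : Fin 3) : B i 0 * N 0 l + B i 1 * N 1 l + B i 2 * N 2 l = if i = l then 1 else 0 := by
    rw [← Matrix.one_apply, ← hinv, Matrix.mul_apply, Fin.sum_univ_three]
  let v (i : Fin 3) : Fin 6 → ℝ :=
    B i 0 • Pi.single 0 1 + B i 1 • Pi.single 1 1 + B i 2 • Pi.single 2 1
  have hvv (i j : Fin 3) (k : Fin 6) (hk : 3 ≤ k) : φ ![v i, v j, Pi.single k 1] = 0 := by
    simp [v, map_add_fst, map_add_snd, map_smul_fst, map_smul_snd, hmix, hk]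
  have hv0 (i : Fin 3) : φ ![v i, Pi.single 4 1, Pi.single 5 1] = if i = 0 then 1 else 0 := by
    simpa [hN, v, map_add_fst, map_smul_fst] using hBN i 0
  have hv1 (i : Fin 3) : φ ![v i, Pi.single 3 1, Pi.single 5 1] = if i = 1 then -1 else 0 := by
    rw [map_swap_snd_trd, ← neg_zero, ← neg_ite, neg_inj]
    simpa [hN, v, map_add_fst, map_smul_fst] using hBN i 1
  have hv2 (i : Fin 3) : φ ![v i, Pi.single 3 1, Pi.single 4 1] = if i = 2 then 1 else 0 := by
    simpa [hN, v, map_add_fst, map_smul_fst] using hBN i 2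
  have key : formPullback (Fintype.linearCombination ℝ
      ![v 0, v 1, v 2, Pi.single 3 1, Pi.single 4 1, Pi.single 5 1]) φ =
      cubicForm (φ ![v 0, v 1, v 2]) 0 1
        (φ ![Pi.single 3 1, Pi.single 4 1, Pi.single 5 1]) := by
    clear_value v
    refine ext_of_lt (forall_lt_lt_fin_six ?_)
    simp only [formPullback_apply, Fintype.linearCombination_apply_single, cubicForm,
      AlternatingMap.add_apply, AlternatingMap.smul_apply, eee_apply]
    simp [hvv, hv0, hv1, hv2]
  obtain ⟨g, hg⟩ := exists_equiv_of_nondegenerate (cubicForm_nondegenerate _ _) key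
  exact ⟨g, _, _, hg⟩

theorem exists_pullback_mixed_eq_zero {φ : (Fin 6 → ℝ) [⋀^Fin 3]→ₗ[ℝ] ℝ}
    (ha : φ ![Pi.single 0 1, Pi.single 1 1, Pi.single 2 1] ≠ 0) :
    ∃ g : (Fin 6 → ℝ) ≃ₗ[ℝ] (Fin 6 → ℝ), ∀ i j k : Fin 6, i < 3 → j < 3 → 3 ≤ k →
      formPullback g.toLinearMap φ ![Pi.single i 1, Pi.single j 1, Pi.single k 1] = 0 := by
  set a := φ ![Pi.single 0 1, Pi.single 1 1, Pi.single 2 1] with ha_def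
  let c (i j k : Fin 6) : ℝ :=
    a⁻¹ * φ ![Pi.single i 1, Pi.single j 1, Pi.single k 1]
  let u (k : Fin 6) : Fin 6 → ℝ := if k < 3 then 0 else
    c 1 2 k • Pi.single 0 1 + c 2 0 k • Pi.single 1 1 + c 0 1 k • Pi.single 2 1
  let l : (Fin 6 → ℝ) →ₗ[ℝ] (Fin 6 → ℝ) := Fintype.linearCombination ℝ u
  have hl (k : Fin 6) : l (Pi.single k 1) = u k := by
    simp [l, Fintype.linearCombination_apply_single]
  have hlu (k : Fin 6) : l (u k) = 0 := by
    by_cases hk : k < 3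
    · simp [u, hk]
    · have hk' : u k = c 1 2 k • Pi.single 0 1 + c 2 0 k • Pi.single 1 1 + c 0 1 k • Pi.single 2 1 :=
        if_neg hk
      rw [hk']
      simp only [map_add, map_smul, hl]
      simp [u]
  have hll : l ∘ₗ l = 0 := by
    refine LinearMap.pi_ext' fun k => LinearMap.ext_ring ?_
    simp [hl, hlu]
  have h1 : (LinearMap.id - l) ∘ₗ (LinearMap.id + l) = LinearMap.id := by
    simp [LinearMap.sub_comp, LinearMap.comp_add, hll]
  have h2 : (LinearMap.id + l) ∘ₗ (LinearMap.id - l) = LinearMap.id := by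
    simp [LinearMap.add_comp, LinearMap.comp_sub, hll]
  refine ⟨LinearEquiv.ofLinearMap _ _ h1 h2, fun i j k hi hj hk => ?_⟩
  have hui : u i = 0 := if_pos hi
  have huj : u j = 0 := if_pos hj
  have huk : u k = c 1 2 k • Pi.single 0 1 + c 2 0 k • Pi.single 1 1 + c 0 1 k • Pi.single 2 1 :=
    if_neg (not_lt.2 hk)
  rw [formPullback_apply]
  simp only [LinearEquiv.toLinearMap_ofLinearMap, LinearMap.sub_apply, LinearMap.id_apply, hl, hui, huj,
    sub_zero]
  rw [sub_eq_add_neg, ← neg_one_smul ℝ (u k), huk]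
  simp only [map_add_trd, map_smul_trd, smul_add, c]
  have h102 : φ ![Pi.single 1 1, Pi.single 0 1, Pi.single 2 1] = -a := map_swap_fst_snd ..
  have h021 : φ ![Pi.single 0 1, Pi.single 2 1, Pi.single 1 1] = -a := map_swap_snd_trd ..
  have h120 : φ ![Pi.single 1 1, Pi.single 2 1, Pi.single 0 1] = a := by rw [map_swap_snd_trd, h102, neg_neg]
  have h201 : φ ![Pi.single 2 1, Pi.single 0 1, Pi.single 1 1] = a := by rw [map_swap_fst_snd, h021, neg_neg]
  have h210 : φ ![Pi.single 2 1, Pi.single 1 1, Pi.single 0 1] = -a := by rw [map_swap_snd_trd, h201]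
  fin_cases i <;> first | exact absurd hi (by decide) | skip
  all_goals fin_cases j <;> first | exact absurd hj (by decide) | skip
  all_goals simp [map_self_fst_snd, map_self_fst_trd, map_self_snd_trd]
  all_goals first
    | rw [map_swap_fst_snd φ (Pi.single 0 1) (Pi.single 1 1)]
    | rw [map_swap_fst_snd φ (Pi.single 2 1) (Pi.single 0 1)]
    | rw [map_swap_fst_snd φ (Pi.single 1 1) (Pi.single 2 1)]
    | skip
  all_goals simp only [h102, h120, h201, h210, h021, ← ha_def]
  all_goals field_simp
  all_goals ring

theorem IsModelForm.of_mixed_eq_zero {φ : (Fin 6 → ℝ) [⋀^Fin 3]→ₗ[ℝ] ℝ} (hφ : IsStableForm φ)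
    (hmix : ∀ i j k : Fin 6, i < 3 → j < 3 → 3 ≤ k →
      φ ![Pi.single i 1, Pi.single j 1, Pi.single k 1] = 0) : IsModelForm φ := by
  let N : Matrix (Fin 3) (Fin 3) ℝ := Matrix.of fun i =>
    ![φ ![Pi.single (i.castAdd 3) 1, Pi.single 4 1, Pi.single 5 1],
      φ ![Pi.single (i.castAdd 3) 1, Pi.single 5 1, Pi.single 3 1],
      φ ![Pi.single (i.castAdd 3) 1, Pi.single 3 1, Pi.single 4 1]]
  obtain ⟨t, ht, g, hg⟩ := hφ.exists_add_smul (cubicForm 0 0 1 0)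
    ((-N).charpoly.rootSet_finite ℝ)
  have hdet : (Matrix.scalar (Fin 3) t - -N).det ≠ 0 := by
    rw [← Matrix.eval_charpoly]
    intro h0
    exact ht (Polynomial.mem_rootSet.2 ⟨(Matrix.charpoly_monic _).ne_zero, by simpa using h0⟩)
  refine .of_pullback g ?_
  have hst := hφ.pullback g
  rw [hg] at hst ⊢
  obtain ⟨k, a, b, hk⟩ : ∃ (k : (Fin 6 → ℝ) ≃ₗ[ℝ] (Fin 6 → ℝ)) (a b : ℝ),
      formPullback k.toLinearMap (φ + t • cubicForm 0 0 1 0) = cubicForm a 0 1 b := by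
    refine exists_pullback_eq_cubicForm (fun i j k hi hj hk => ?_) (fun i => ?_) hdet
    · rw [AlternatingMap.add_apply, hmix i j k hi hj hk]
      fin_cases k <;> first | exact absurd hk (by decide) | skip
      all_goals fin_cases i <;> first | exact absurd hi (by decide) | skip
      all_goals fin_cases j <;> first | exact absurd hj (by decide) | simp [cubicForm, eee_apply]
    · ext m
      fin_cases i <;> fin_cases m <;> simp [N, cubicForm, eee_apply, add_comm]
  exact .of_pullback k (hk ▸ .of_cubicForm (hk ▸ hst.pullback k))

theorem IsStableForm.isModelForm {φ : (Fin 6 → ℝ) [⋀^Fin 3]→ₗ[ℝ] ℝ} (hφ : IsStableForm φ) :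
    IsModelForm φ := by
  obtain ⟨t, ht, g, hg⟩ := hφ.exists_add_smul (eee 0 1 2)
    (Set.finite_singleton (-φ ![Pi.single 0 1, Pi.single 1 1, Pi.single 2 1]))
  have hst := hφ.pullback g
  refine .of_pullback g ?_
  obtain ⟨k, hk⟩ := exists_pullback_mixed_eq_zero (φ := formPullback g.toLinearMap φ) <| by
    rw [hg]
    simp [eee_apply]
    exact fun h0 => ht (by rw [Set.mem_singleton_iff]; linarith)
  exact .of_pullback k (.of_mixed_eq_zero (hst.pullback k) hk)

/-- Every stable 3-form on `ℝ⁶` is equivalent to exactly one of `γ₁`, `γ₂`. -/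

theorem stable_three_form_dim_six_classification (γ : (Fin 6 → ℝ) [⋀^Fin 3]→ₗ[ℝ] ℝ)
    (hγ : IsStableForm γ) :
    Xor' (∃ g : (Fin 6 → ℝ) ≃ₗ[ℝ] (Fin 6 → ℝ), formPullback g.toLinearMap γ = gammaOne)
         (∃ g : (Fin 6 → ℝ) ≃ₗ[ℝ] (Fin 6 → ℝ), formPullback g.toLinearMap γ = gammaTwo) := by
  refine (xor_iff_or_and_not_and _ _).2 ⟨hγ.isModelForm, ?_⟩
  rintro ⟨⟨g, hg⟩, k, hk⟩
  refine not_equiv_gammaOne_gammaTwo (g.trans k.symm) ?_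
  rw [← hg, ← hk, formPullback_formPullback]
  congr 1
  ext
  simp
end
end

section
/- Every stable 3-form γ on ℝ^7 is equivalent to exactly one of the forms ω_1 = e^{123} − e^{145} + e^{167} + e^{246} + e^{257} + e^{347} − e^{356} or ω_2 = e^{123} + e^{145} − e^{167} + e^{246} + e^{257} + e^{347} − e^{356}; that is, there exists g ∈ GL(7,ℝ) with g^*γ equal to ω_1 or ω_2. -/
noncomputable section

/-- The form `ω₁ = e^{123} - e^{145} + e^{167} + e^{246} + e^{257} + e^{347} - e^{356}`
on `ℝ⁷` (of `G₂`-type). -/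
def omegaOne : (Fin 7 → ℝ) [⋀^Fin 3]→ₗ[ℝ] ℝ :=
  eee 0 1 2 - eee 0 3 4 + eee 0 5 6 + eee 1 3 5 + eee 1 4 6 + eee 2 3 6 - eee 2 4 5

/-- The form `ω₂ = e^{123} + e^{145} - e^{167} + e^{246} + e^{257} + e^{347} - e^{356}`
on `ℝ⁷` (of `G̃₂`-type). -/
def omegaTwo : (Fin 7 → ℝ) [⋀^Fin 3]→ₗ[ℝ] ℝ :=
  eee 0 1 2 + eee 0 3 4 - eee 0 5 6 + eee 1 3 5 + eee 1 4 6 + eee 2 3 6 - eee 2 4 5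

/-- Alternating 3-forms on `ℝ⁷`. -/
abbrev ThreeForm := (Fin 7 → ℝ) [⋀^Fin 3]→ₗ[ℝ] ℝ

/-- A 3-form as a function of three vectors. -/
def tri (φ : ThreeForm) (x y z : Fin 7 → ℝ) : ℝ := φ ![x, y, z]

/-- The standard basis vectors of `ℝ⁷`. -/
def bv (i : Fin 7) : Fin 7 → ℝ := Pi.single i 1

lemma bv_apply (i j : Fin 7) : bv i j = if j = i then 1 else 0 := Pi.single_apply i 1 j

section Trilinear

variable (φ : ThreeForm) (a : ℝ) (x x' y z : Fin 7 → ℝ)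

lemma tri_swap_left : tri φ y x z = -tri φ x y z := by
  have h := φ.map_swap ![x, y, z] (i := 0) (j := 1) (by decide)
  rw [tri, tri, ← h]
  congr 1
  ext i
  fin_cases i <;> rfl

lemma tri_swap_right : tri φ x z y = -tri φ x y z := by
  have h := φ.map_swap ![x, y, z] (i := 1) (j := 2) (by decide)
  rw [tri, tri, ← h]
  congr 1
  ext i
  fin_cases i <;> rfl

@[simp] lemma tri_add_left : tri φ (x + x') y z = tri φ x y z + tri φ x' y z :=
  φ.toMultilinearMap.cons_add ![y, z] x x'

@[simp] lemma tri_smul_left : tri φ (a • x) y z = a * tri φ x y z :=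
  φ.toMultilinearMap.cons_smul ![y, z] a x

@[simp] lemma tri_add_mid : tri φ y (x + x') z = tri φ y x z + tri φ y x' z := by
  rw [tri_swap_left, tri_add_left, tri_swap_left φ y x, tri_swap_left φ y x']; ring

@[simp] lemma tri_smul_mid : tri φ y (a • x) z = a * tri φ y x z := by
  rw [tri_swap_left, tri_smul_left, tri_swap_left φ y x]; ring

@[simp] lemma tri_add_right : tri φ y z (x + x') = tri φ y z x + tri φ y z x' := by
  rw [tri_swap_right, tri_add_mid, tri_swap_right φ y z x, tri_swap_right φ y z x']; ring

@[simp] lemma tri_smul_right : tri φ y z (a • x) = a * tri φ y z x := by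
  rw [tri_swap_right, tri_smul_mid, tri_swap_right φ y z x]; ring

@[simp] lemma tri_neg_left : tri φ (-x) y z = -tri φ x y z := by
  rw [← neg_one_smul ℝ x, tri_smul_left, neg_one_mul]

@[simp] lemma tri_neg_mid : tri φ y (-x) z = -tri φ y x z := by
  rw [← neg_one_smul ℝ x, tri_smul_mid, neg_one_mul]

@[simp] lemma tri_neg_right : tri φ y z (-x) = -tri φ y z x := by
  rw [← neg_one_smul ℝ x, tri_smul_right, neg_one_mul]

@[simp] lemma tri_self_left : tri φ x x z = 0 := by
  have := tri_swap_left φ x x z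
  linarith

@[simp] lemma tri_self_right : tri φ x z z = 0 := by
  have := tri_swap_right φ x z z
  linarith

@[simp] lemma tri_self_outer : tri φ x y x = 0 := by
  rw [tri_swap_right, tri_self_left, neg_zero]

@[simp] lemma tri_sort_left {i j : Fin 7} (_ : i < j) :
    tri φ (bv j) (bv i) z = -tri φ (bv i) (bv j) z := tri_swap_left ..

@[simp] lemma tri_sort_right {i j : Fin 7} (_ : i < j) :
    tri φ z (bv j) (bv i) = -tri φ z (bv i) (bv j) := tri_swap_right ..

end Trilinear

lemma tri_eee_apply (i j k : Fin 7) (x y z : Fin 7 → ℝ) :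
    tri (eee i j k) x y z = !![x i, x j, x k; y i, y j, y k; z i, z j, z k].det := by
  simp only [tri, eee, covectorWedge, AlternatingMap.compLinearMap_apply]
  change Matrix.det _ = Matrix.det _
  congr 1
  ext r c
  fin_cases r <;> fin_cases c <;> rfl

@[simp] lemma tri_eee_of_lt {i j k l m n : Fin 7} (hij : i < j) (hjk : j < k) (hlm : l < m)
    (hmn : m < n) : tri (eee i j k) (bv l) (bv m) (bv n) =
      if i = l ∧ j = m ∧ k = n then 1 else 0 := by
  simp only [tri_eee_apply, bv_apply, Matrix.det_fin_three, Matrix.of_apply, Matrix.cons_val]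
  grind

@[simp] lemma tri_add (φ ψ : ThreeForm) (x y z : Fin 7 → ℝ) :
    tri (φ + ψ) x y z = tri φ x y z + tri ψ x y z := rfl

@[simp] lemma tri_sub (φ ψ : ThreeForm) (x y z : Fin 7 → ℝ) :
    tri (φ - ψ) x y z = tri φ x y z - tri ψ x y z := rfl

@[simp] lemma tri_smul (a : ℝ) (φ : ThreeForm) (x y z : Fin 7 → ℝ) :
    tri (a • φ) x y z = a * tri φ x y z := rfl

/-- To check a property of increasing triples of indices, check the 35 triples. -/
lemma forall_increasing (P : Fin 7 → Fin 7 → Fin 7 → Prop)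
    (h : P 0 1 2 ∧ P 0 1 3 ∧ P 0 1 4 ∧ P 0 1 5 ∧ P 0 1 6 ∧ P 0 2 3 ∧ P 0 2 4 ∧ P 0 2 5 ∧ P 0 2 6 ∧
      P 0 3 4 ∧ P 0 3 5 ∧ P 0 3 6 ∧ P 0 4 5 ∧ P 0 4 6 ∧ P 0 5 6 ∧ P 1 2 3 ∧ P 1 2 4 ∧ P 1 2 5 ∧
      P 1 2 6 ∧ P 1 3 4 ∧ P 1 3 5 ∧ P 1 3 6 ∧ P 1 4 5 ∧ P 1 4 6 ∧ P 1 5 6 ∧ P 2 3 4 ∧ P 2 3 5 ∧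
      P 2 3 6 ∧ P 2 4 5 ∧ P 2 4 6 ∧ P 2 5 6 ∧ P 3 4 5 ∧ P 3 4 6 ∧ P 3 5 6 ∧ P 4 5 6)
    (i j k : Fin 7) (hij : i < j) (hjk : j < k) : P i j k := by
  fin_cases i <;> fin_cases j <;> simp at hij <;> fin_cases k <;> simp at hjk <;> simp [h]

/-- Two 3-forms with the same components are equal. -/
lemma threeForm_ext {φ ψ : ThreeForm} (h : ∀ i j k : Fin 7, i < j → j < k →
    tri φ (bv i) (bv j) (bv k) = tri ψ (bv i) (bv j) (bv k)) : φ = ψ := by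
  have key : ∀ i j k : Fin 7,
      tri φ (bv i) (bv j) (bv k) = tri ψ (bv i) (bv j) (bv k) := by
    intro i j k
    rcases lt_trichotomy i j with hij | rfl | hij
    · rcases lt_trichotomy j k with hjk | rfl | hjk
      · exact h i j k hij hjk
      · simp [tri_self_right]
      · rcases lt_trichotomy i k with hik | rfl | hik
        · rw [tri_sort_right φ _ hjk, tri_sort_right ψ _ hjk, h i k j hik hjk]
        · simp [tri_self_outer]
        · rw [tri_sort_right φ _ hjk, tri_sort_right ψ _ hjk, tri_sort_left φ _ hik,
            tri_sort_left ψ _ hik, h k i j hik hij]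
    · simp [tri_self_left]
    · rw [tri_sort_left φ _ hij, tri_sort_left ψ _ hij]
      rcases lt_trichotomy i k with hik | rfl | hik
      · rw [h j i k hij hik]
      · simp [tri_self_right]
      · rw [tri_sort_right φ _ hik, tri_sort_right ψ _ hik]
        rcases lt_trichotomy j k with hjk | rfl | hjk
        · rw [h j k i hjk hik]
        · simp [tri_self_left]
        · rw [tri_sort_left φ _ hjk, tri_sort_left ψ _ hjk, h k j i hjk hij]
  refine Module.Basis.ext_alternating (Pi.basisFun ℝ (Fin 7)) fun v _ => ?_
  have hv : (fun i => Pi.basisFun ℝ (Fin 7) (v i)) = ![bv (v 0), bv (v 1), bv (v 2)] := by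
    ext i
    fin_cases i <;> simp [bv]
  rw [hv]
  exact key _ _ _

/-- An open union of `GL(7,ℝ)`-orbits of 3-forms. -/
structure IsOpenInvariant (S : Set ThreeForm) : Prop where
  isOpen : IsOpen S
  pullback_mem : ∀ φ ∈ S, ∀ g : (Fin 7 → ℝ) ≃ₗ[ℝ] (Fin 7 → ℝ), formPullback g.toLinearMap φ ∈ S

/-- Changing the frame from the standard one to `w`, with change of basis matrix inverse to `w'`. -/
lemma IsOpenInvariant.exists_frame {S : Set ThreeForm} (hS : IsOpenInvariant S) {φ : ThreeForm}
    (hφ : φ ∈ S) (w w' : Fin 7 → Fin 7 → ℝ) (h : Matrix.of w * Matrix.of w' = 1) :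
    ∃ φ' ∈ S, ∀ i j k, tri φ' (bv i) (bv j) (bv k) = tri φ (w i) (w j) (w k) := by
  have h' : Matrix.of w' * Matrix.of w = 1 := mul_eq_one_comm.mp h
  let g : (Fin 7 → ℝ) ≃ₗ[ℝ] (Fin 7 → ℝ) :=
    Matrix.toLin'OfInv (M := (Matrix.of w').transpose) (M' := (Matrix.of w).transpose)
      (by rw [← Matrix.transpose_mul, h, Matrix.transpose_one])
      (by rw [← Matrix.transpose_mul, h', Matrix.transpose_one])
  have hg : ∀ i, g (bv i) = w i := by
    intro i
    change Matrix.toLin' (Matrix.of w).transpose (Pi.single i 1) = w i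
    rw [Matrix.toLin'_apply, Matrix.mulVec_single_one]
    rfl
  refine ⟨formPullback g.toLinearMap φ, hS.pullback_mem φ hφ g, fun i j k => ?_⟩
  rw [← hg i, ← hg j, ← hg k]
  simp only [tri, formPullback, AlternatingMap.compLinearMap_apply]
  congr 1
  ext r
  fin_cases r <;> rfl

open Polynomial in
/-- A small perturbation of `φ` along `ψ` stays in an open set and avoids the zeros of any given
nonzero polynomial. -/
lemma IsOpenInvariant.exists_perturb {S : Set ThreeForm} (hS : IsOpenInvariant S) {φ : ThreeForm}
    (hφ : φ ∈ S) (ψ : ThreeForm) {p : ℝ[X]} (hp : p ≠ 0) :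
    ∃ t : ℝ, φ + t • ψ ∈ S ∧ p.eval t ≠ 0 := by
  have hc : Continuous fun t : ℝ => φ + t • ψ := by
    refine continuous_induced_rng.mpr (continuous_pi fun v => ?_)
    change Continuous fun t : ℝ => φ v + t * ψ v
    fun_prop
  have hU : IsOpen ((fun t : ℝ => φ + t • ψ) ⁻¹' S) := hS.isOpen.preimage hc
  have hinf : ((fun t : ℝ => φ + t • ψ) ⁻¹' S).Infinite :=
    infinite_of_mem_nhds 0 (hU.mem_nhds (by simpa using hφ))
  obtain ⟨t, ht, ht'⟩ := hinf.exists_notMem_finset p.roots.toFinset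
  exact ⟨t, ht, fun h0 => ht' (by simpa [hp] using h0)⟩

local notation φ "⟦" i "," j "," k "⟧" => tri φ (bv i) (bv j) (bv k)

/-- After a change of frame, the form vanishes on the span of the last four basis vectors. -/
lemma exists_vanishing {S : Set ThreeForm} (hS : IsOpenInvariant S) (hne : S.Nonempty) :
    ∃ φ ∈ S, φ⟦3, 4, 5⟧ = 0 ∧ φ⟦3, 4, 6⟧ = 0 ∧ φ⟦3, 5, 6⟧ = 0 ∧ φ⟦4, 5, 6⟧ = 0 := by
  obtain ⟨φ₀, hφ₀⟩ := hne
  obtain ⟨φ, hφ, hP⟩ : ∃ φ ∈ S,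
      φ⟦0, 3, 4⟧ * φ⟦0, 5, 6⟧ - φ⟦0, 3, 5⟧ * φ⟦0, 4, 6⟧ + φ⟦0, 3, 6⟧ * φ⟦0, 4, 5⟧ ≠ 0 := by
    obtain ⟨t, ht, ht'⟩ := hS.exists_perturb hφ₀ (eee 0 3 4 + eee 0 5 6)
      (p := Polynomial.C 1 * Polynomial.X ^ 2
        + Polynomial.C (φ₀⟦0, 3, 4⟧ + φ₀⟦0, 5, 6⟧) * Polynomial.X
        + Polynomial.C (φ₀⟦0, 3, 4⟧ * φ₀⟦0, 5, 6⟧ - φ₀⟦0, 3, 5⟧ * φ₀⟦0, 4, 6⟧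
          + φ₀⟦0, 3, 6⟧ * φ₀⟦0, 4, 5⟧))
      (Polynomial.ne_zero_of_natDegree_gt (n := 0)
        (by rw [Polynomial.natDegree_quadratic one_ne_zero]; norm_num))
    refine ⟨_, ht, ?_⟩
    convert ht' using 1
    simp
    ring
  set P := φ⟦0, 3, 4⟧ * φ⟦0, 5, 6⟧ - φ⟦0, 3, 5⟧ * φ⟦0, 4, 6⟧ + φ⟦0, 3, 6⟧ * φ⟦0, 4, 5⟧ with hPdef
  obtain ⟨t₃, h₃⟩ : ∃ t, t = (-(φ⟦0, 3, 4⟧ * φ⟦3, 5, 6⟧) + φ⟦0, 3, 5⟧ * φ⟦3, 4, 6⟧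
    - φ⟦0, 3, 6⟧ * φ⟦3, 4, 5⟧) / P := ⟨_, rfl⟩
  obtain ⟨t₄, h₄⟩ : ∃ t, t = (-(φ⟦0, 3, 4⟧ * φ⟦4, 5, 6⟧) + φ⟦0, 4, 5⟧ * φ⟦3, 4, 6⟧
    - φ⟦0, 4, 6⟧ * φ⟦3, 4, 5⟧) / P := ⟨_, rfl⟩
  obtain ⟨t₅, h₅⟩ : ∃ t, t = (-(φ⟦0, 3, 5⟧ * φ⟦4, 5, 6⟧) + φ⟦0, 4, 5⟧ * φ⟦3, 5, 6⟧
    - φ⟦0, 5, 6⟧ * φ⟦3, 4, 5⟧) / P := ⟨_, rfl⟩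
  obtain ⟨t₆, h₆⟩ : ∃ t, t = (-(φ⟦0, 3, 6⟧ * φ⟦4, 5, 6⟧) + φ⟦0, 4, 6⟧ * φ⟦3, 5, 6⟧
    - φ⟦0, 5, 6⟧ * φ⟦3, 4, 6⟧) / P := ⟨_, rfl⟩
  obtain ⟨φ', hφ', h'⟩ := hS.exists_frame hφ
    ![bv 0, bv 1, bv 2, bv 3 + t₃ • bv 0, bv 4 + t₄ • bv 0, bv 5 + t₅ • bv 0, bv 6 + t₆ • bv 0]
    ![bv 0, bv 1, bv 2, bv 3 + (-t₃) • bv 0, bv 4 + (-t₄) • bv 0, bv 5 + (-t₅) • bv 0,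
      bv 6 + (-t₆) • bv 0]
    (by
      ext i j
      fin_cases i <;> fin_cases j <;>
        simp [Matrix.mul_apply, Fin.sum_univ_seven, bv_apply])
  refine ⟨φ', hφ', ?_, ?_, ?_, ?_⟩ <;>
    simp [h', h₃, h₄, h₅, h₆] <;>
    field_simp <;> rw [hPdef] <;> ring

/-- `φ` vanishes on the span `C` of the last four basis vectors `c₀, …, c₃`, and the first three
basis vectors `e₁, e₂, e₃` satisfy `φ(eᵢ, c₀, cⱼ) = δᵢⱼ`. -/
def IsPaired (φ : ThreeForm) : Prop :=
  (φ⟦3, 4, 5⟧ = 0 ∧ φ⟦3, 4, 6⟧ = 0 ∧ φ⟦3, 5, 6⟧ = 0 ∧ φ⟦4, 5, 6⟧ = 0) ∧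
  (φ⟦0, 3, 4⟧ = 1 ∧ φ⟦0, 3, 5⟧ = 0 ∧ φ⟦0, 3, 6⟧ = 0) ∧
  (φ⟦1, 3, 4⟧ = 0 ∧ φ⟦1, 3, 5⟧ = 1 ∧ φ⟦1, 3, 6⟧ = 0) ∧
  (φ⟦2, 3, 4⟧ = 0 ∧ φ⟦2, 3, 5⟧ = 0 ∧ φ⟦2, 3, 6⟧ = 1)

/-- The pairing between the first three basis vectors and `c₁, c₂, c₃` can be made perfect. -/
lemma exists_isPaired {S : Set ThreeForm} (hS : IsOpenInvariant S) (hne : S.Nonempty) :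
    ∃ φ ∈ S, IsPaired φ := by
  obtain ⟨φ₀, hφ₀, h₀⟩ := exists_vanishing hS hne
  obtain ⟨φ, hφ, hC, hD⟩ : ∃ φ ∈ S,
      (φ⟦3, 4, 5⟧ = 0 ∧ φ⟦3, 4, 6⟧ = 0 ∧ φ⟦3, 5, 6⟧ = 0 ∧ φ⟦4, 5, 6⟧ = 0) ∧
      !![φ⟦0, 3, 4⟧, φ⟦0, 3, 5⟧, φ⟦0, 3, 6⟧;
         φ⟦1, 3, 4⟧, φ⟦1, 3, 5⟧, φ⟦1, 3, 6⟧;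
         φ⟦2, 3, 4⟧, φ⟦2, 3, 5⟧, φ⟦2, 3, 6⟧].det ≠ 0 := by
    obtain ⟨t, ht, ht'⟩ := hS.exists_perturb hφ₀ (eee 0 3 4 + eee 1 3 5 + eee 2 3 6)
      (p := Polynomial.C 1 * Polynomial.X ^ 3
        + Polynomial.C (φ₀⟦0, 3, 4⟧ + φ₀⟦1, 3, 5⟧ + φ₀⟦2, 3, 6⟧) * Polynomial.X ^ 2
        + Polynomial.C (φ₀⟦0, 3, 4⟧ * φ₀⟦1, 3, 5⟧ - φ₀⟦0, 3, 5⟧ * φ₀⟦1, 3, 4⟧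
          + φ₀⟦0, 3, 4⟧ * φ₀⟦2, 3, 6⟧ - φ₀⟦0, 3, 6⟧ * φ₀⟦2, 3, 4⟧
          + φ₀⟦1, 3, 5⟧ * φ₀⟦2, 3, 6⟧ - φ₀⟦1, 3, 6⟧ * φ₀⟦2, 3, 5⟧) * Polynomial.X
        + Polynomial.C (!![φ₀⟦0, 3, 4⟧, φ₀⟦0, 3, 5⟧, φ₀⟦0, 3, 6⟧;
          φ₀⟦1, 3, 4⟧, φ₀⟦1, 3, 5⟧, φ₀⟦1, 3, 6⟧;
          φ₀⟦2, 3, 4⟧, φ₀⟦2, 3, 5⟧, φ₀⟦2, 3, 6⟧].det))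
      (Polynomial.ne_zero_of_natDegree_gt (n := 0)
        (by rw [Polynomial.natDegree_cubic one_ne_zero]; norm_num))
    refine ⟨_, ht, by simp [h₀], ?_⟩
    convert ht' using 1
    simp [Matrix.det_fin_three]
    ring
  set D := !![φ⟦0, 3, 4⟧, φ⟦0, 3, 5⟧, φ⟦0, 3, 6⟧; φ⟦1, 3, 4⟧, φ⟦1, 3, 5⟧, φ⟦1, 3, 6⟧;
    φ⟦2, 3, 4⟧, φ⟦2, 3, 5⟧, φ⟦2, 3, 6⟧] with hDdef
  obtain ⟨E, hE⟩ : ∃ E, D * E = 1 := ⟨D⁻¹, D.mul_nonsing_inv (isUnit_iff_ne_zero.mpr hD)⟩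
  have hDE : ∀ i j, D i 0 * E 0 j + D i 1 * E 1 j + D i 2 * E 2 j = if i = j then 1 else 0 := by
    intro i j
    rw [← Matrix.one_apply, ← hE, Matrix.mul_apply, Fin.sum_univ_three]
  obtain ⟨φ', hφ', h'⟩ := hS.exists_frame hφ
    ![bv 0, bv 1, bv 2, bv 3, E 0 0 • bv 4 + E 1 0 • bv 5 + E 2 0 • bv 6,
      E 0 1 • bv 4 + E 1 1 • bv 5 + E 2 1 • bv 6, E 0 2 • bv 4 + E 1 2 • bv 5 + E 2 2 • bv 6]
    ![bv 0, bv 1, bv 2, bv 3, D 0 0 • bv 4 + D 1 0 • bv 5 + D 2 0 • bv 6,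
      D 0 1 • bv 4 + D 1 1 • bv 5 + D 2 1 • bv 6, D 0 2 • bv 4 + D 1 2 • bv 5 + D 2 2 • bv 6]
    (by
      clear_value D
      ext i j
      have h₀ := hDE 0
      have h₁ := hDE 1
      have h₂ := hDE 2
      simp [Fin.forall_fin_succ] at h₀ h₁ h₂
      fin_cases i <;> fin_cases j <;>
        simp [Matrix.mul_apply, Fin.sum_univ_seven, bv_apply] <;>
        linarith)
  refine ⟨φ', hφ', by simp [h', hC], ?_, ?_, ?_⟩
  · refine ⟨?_, ?_, ?_⟩
    · simpa [h', hDdef, mul_comm, add_assoc] using hDE 0 0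
    · simpa [h', hDdef, mul_comm, add_assoc] using hDE 0 1
    · simpa [h', hDdef, mul_comm, add_assoc] using hDE 0 2
  · refine ⟨?_, ?_, ?_⟩
    · simpa [h', hDdef, mul_comm, add_assoc] using hDE 1 0
    · simpa [h', hDdef, mul_comm, add_assoc] using hDE 1 1
    · simpa [h', hDdef, mul_comm, add_assoc] using hDE 1 2
  · refine ⟨?_, ?_, ?_⟩
    · simpa [h', hDdef, mul_comm, add_assoc] using hDE 2 0
    · simpa [h', hDdef, mul_comm, add_assoc] using hDE 2 1
    · simpa [h', hDdef, mul_comm, add_assoc] using hDE 2 2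

/-- The `3 × 3` matrix `Tᵢⱼ = φ(eᵢ, cₖ, cₗ)`, for cyclic permutations `(j, k, l)` of `(1, 2, 3)`,
can be made symmetric. -/
lemma exists_symmetric {S : Set ThreeForm} (hS : IsOpenInvariant S) (hne : S.Nonempty) :
    ∃ φ ∈ S, IsPaired φ ∧
      φ⟦1, 5, 6⟧ = -φ⟦0, 4, 6⟧ ∧ φ⟦2, 5, 6⟧ = φ⟦0, 4, 5⟧ ∧ φ⟦2, 4, 6⟧ = -φ⟦1, 4, 5⟧ := by
  obtain ⟨φ, hφ, hp⟩ := exists_isPaired hS hne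
  rw [IsPaired] at hp
  obtain ⟨t₁, h₁⟩ : ∃ t, t = -(φ⟦1, 4, 5⟧ + φ⟦2, 4, 6⟧) / 2 := ⟨_, rfl⟩
  obtain ⟨t₂, h₂⟩ : ∃ t, t = (φ⟦0, 4, 5⟧ - φ⟦2, 5, 6⟧) / 2 := ⟨_, rfl⟩
  obtain ⟨t₃, h₃⟩ : ∃ t, t = (φ⟦1, 5, 6⟧ + φ⟦0, 4, 6⟧) / 2 := ⟨_, rfl⟩
  obtain ⟨φ', hφ', h'⟩ := hS.exists_frame hφ
    ![bv 0, bv 1, bv 2, bv 3, bv 4 + t₁ • bv 3, bv 5 + t₂ • bv 3, bv 6 + t₃ • bv 3]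
    ![bv 0, bv 1, bv 2, bv 3, bv 4 + (-t₁) • bv 3, bv 5 + (-t₂) • bv 3, bv 6 + (-t₃) • bv 3]
    (by
      ext i j
      fin_cases i <;> fin_cases j <;>
        simp [Matrix.mul_apply, Fin.sum_univ_seven, bv_apply])
  refine ⟨φ', hφ', by simp [IsPaired, h', hp], ?_, ?_, ?_⟩ <;>
    simp [h', hp, h₁, h₂, h₃] <;> ring

/-- The first row of the symmetric matrix `T` can be cleared off the diagonal. -/
lemma exists_symmetric_row {S : Set ThreeForm} (hS : IsOpenInvariant S) (hne : S.Nonempty) :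
    ∃ φ ∈ S, IsPaired φ ∧ φ⟦0, 5, 6⟧ ≠ 0 ∧
      (φ⟦0, 4, 6⟧ = 0 ∧ φ⟦0, 4, 5⟧ = 0 ∧ φ⟦1, 5, 6⟧ = 0 ∧ φ⟦2, 5, 6⟧ = 0) ∧
      φ⟦2, 4, 6⟧ = -φ⟦1, 4, 5⟧ := by
  obtain ⟨φ₀, hφ₀, hp₀, h₀⟩ := exists_symmetric hS hne
  obtain ⟨φ, hφ, hp, hne, hs⟩ : ∃ φ ∈ S, IsPaired φ ∧ φ⟦0, 5, 6⟧ ≠ 0 ∧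
      φ⟦1, 5, 6⟧ = -φ⟦0, 4, 6⟧ ∧ φ⟦2, 5, 6⟧ = φ⟦0, 4, 5⟧ ∧ φ⟦2, 4, 6⟧ = -φ⟦1, 4, 5⟧ := by
    obtain ⟨t, ht, ht'⟩ := hS.exists_perturb hφ₀ (eee 0 5 6)
      (Polynomial.X_add_C_ne_zero (φ₀⟦0, 5, 6⟧))
    rw [IsPaired] at hp₀
    refine ⟨_, ht, ?_, ?_, ?_⟩
    · simp [IsPaired, hp₀]
    · simpa [add_comm] using ht'
    · simp [h₀]
  rw [IsPaired] at hp
  obtain ⟨p, hp'⟩ : ∃ p, p = φ⟦0, 4, 6⟧ / φ⟦0, 5, 6⟧ := ⟨_, rfl⟩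
  obtain ⟨q, hq'⟩ : ∃ q, q = -φ⟦0, 4, 5⟧ / φ⟦0, 5, 6⟧ := ⟨_, rfl⟩
  obtain ⟨φ', hφ', h'⟩ := hS.exists_frame hφ
    ![bv 0, bv 1 + p • bv 0, bv 2 + q • bv 0, bv 3, bv 4 + (-p) • bv 5 + (-q) • bv 6, bv 5, bv 6]
    ![bv 0, bv 1 + (-p) • bv 0, bv 2 + (-q) • bv 0, bv 3, bv 4 + p • bv 5 + q • bv 6, bv 5, bv 6]
    (by
      ext i j
      fin_cases i <;> fin_cases j <;>
        simp [Matrix.mul_apply, Fin.sum_univ_seven, bv_apply])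
  refine ⟨φ', hφ', by simp [IsPaired, h', hp], by simpa [h'] using hne, ⟨?_, ?_, ?_, ?_⟩, ?_⟩ <;>
    simp [h', hs, hp', hq'] <;> field_simp <;> ring

/-- The symmetric matrix `T` can be made diagonal and invertible. -/
lemma exists_diagonal {S : Set ThreeForm} (hS : IsOpenInvariant S) (hne : S.Nonempty) :
    ∃ φ ∈ S, IsPaired φ ∧ (φ⟦0, 5, 6⟧ ≠ 0 ∧ φ⟦1, 4, 6⟧ ≠ 0 ∧ φ⟦2, 4, 5⟧ ≠ 0) ∧
      (φ⟦0, 4, 6⟧ = 0 ∧ φ⟦0, 4, 5⟧ = 0 ∧ φ⟦1, 5, 6⟧ = 0 ∧ φ⟦2, 5, 6⟧ = 0 ∧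
      φ⟦1, 4, 5⟧ = 0 ∧ φ⟦2, 4, 6⟧ = 0) := by
  obtain ⟨φ₀, hφ₀, hp₀, hne₀, h₀, hs₀⟩ := exists_symmetric_row hS hne
  rw [IsPaired] at hp₀
  obtain ⟨t, ht, ht'⟩ := hS.exists_perturb hφ₀ (eee 1 4 6)
    (Polynomial.X_add_C_ne_zero (φ₀⟦1, 4, 6⟧))
  obtain ⟨r, hr⟩ : ∃ r, r = φ₀⟦1, 4, 5⟧ / (t + φ₀⟦1, 4, 6⟧) := ⟨_, rfl⟩
  obtain ⟨φ₁, hφ₁, h₁⟩ := hS.exists_frame ht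
    ![bv 0, bv 1, bv 2 + r • bv 1, bv 3, bv 4, bv 5 + (-r) • bv 6, bv 6]
    ![bv 0, bv 1, bv 2 + (-r) • bv 1, bv 3, bv 4, bv 5 + r • bv 6, bv 6]
    (by
      ext i j
      fin_cases i <;> fin_cases j <;>
        simp [Matrix.mul_apply, Fin.sum_univ_seven, bv_apply])
  obtain ⟨u, hu, hu'⟩ := hS.exists_perturb hφ₁ (eee 2 4 5)
    (Polynomial.X_add_C_ne_zero (φ₁⟦2, 4, 5⟧))
  simp only [Polynomial.eval_add, Polynomial.eval_X, Polynomial.eval_C] at ht' hu'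
  refine ⟨_, hu, ?_, ⟨?_, ?_, ?_⟩, ?_, ?_, ?_, ?_, ?_, ?_⟩
  · simp [IsPaired, h₁, hp₀]
  · simpa [h₁, h₀] using hne₀
  · simpa [h₁, h₀, add_comm] using ht'
  · simpa [add_comm] using hu'
  all_goals simp [h₁, h₀, hs₀]
  all_goals
    rw [hr]
    field_simp
    ring
/-- The 3-form with components `a` at `012`, unit pairings `034`, `135`, `236`, and components
`t₀, t₁, t₂` at `056`, `146`, `245`. -/
def normalForm (a t₀ t₁ t₂ : ℝ) : ThreeForm :=
  a • eee 0 1 2 + eee 0 3 4 + eee 1 3 5 + eee 2 3 6 + t₀ • eee 0 5 6 + t₁ • eee 1 4 6 +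
    t₂ • eee 2 4 5

set_option maxHeartbeats 1000000 in
lemma exists_normalForm {S : Set ThreeForm} (hS : IsOpenInvariant S) (hne : S.Nonempty) :
    ∃ a t₀ t₁ t₂, a ≠ 0 ∧ t₀ ≠ 0 ∧ t₁ ≠ 0 ∧ t₂ ≠ 0 ∧ normalForm a t₀ t₁ t₂ ∈ S := by
  obtain ⟨φ, hφ, hp, ⟨hne₀, hne₁, hne₂⟩, h₀⟩ := exists_diagonal hS hne
  rw [IsPaired] at hp
  obtain ⟨τ₀, e₀⟩ : ∃ t, φ⟦0, 5, 6⟧ = t := ⟨_, rfl⟩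
  obtain ⟨τ₁, e₁⟩ : ∃ t, φ⟦1, 4, 6⟧ = t := ⟨_, rfl⟩
  obtain ⟨τ₂, e₂⟩ : ∃ t, φ⟦2, 4, 5⟧ = t := ⟨_, rfl⟩
  rw [e₀] at hne₀
  rw [e₁] at hne₁
  rw [e₂] at hne₂
  obtain ⟨x₁₄, h₁₄⟩ : ∃ x, x = (φ⟦1, 2, 5⟧ + τ₂ * φ⟦0, 1, 3⟧ - φ⟦0, 2, 4⟧) / (2 * τ₂) := ⟨_, rfl⟩
  obtain ⟨x₀₅, h₀₅⟩ : ∃ x, x = x₁₄ - φ⟦0, 1, 3⟧ := ⟨_, rfl⟩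
  obtain ⟨x₂₃, h₂₃⟩ : ∃ x, x = τ₂ * x₁₄ - φ⟦1, 2, 5⟧ := ⟨_, rfl⟩
  obtain ⟨x₀₆, h₀₆⟩ : ∃ x, x = -(φ⟦0, 1, 4⟧ + φ⟦1, 2, 6⟧ + τ₁ * φ⟦0, 2, 3⟧) / (2 * τ₁) := ⟨_, rfl⟩
  obtain ⟨x₁₃, h₁₃⟩ : ∃ x, x = -τ₁ * x₀₆ - φ⟦0, 1, 4⟧ := ⟨_, rfl⟩
  obtain ⟨x₂₄, h₂₄⟩ : ∃ x, x = x₀₆ + φ⟦0, 2, 3⟧ := ⟨_, rfl⟩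
  obtain ⟨x₁₆, h₁₆⟩ : ∃ x, x = (φ⟦0, 1, 5⟧ - φ⟦0, 2, 6⟧ - τ₀ * φ⟦1, 2, 3⟧) / (2 * τ₀) := ⟨_, rfl⟩
  obtain ⟨x₀₃, h₀₃⟩ : ∃ x, x = φ⟦0, 1, 5⟧ - τ₀ * x₁₆ := ⟨_, rfl⟩
  obtain ⟨x₂₅, h₂₅⟩ : ∃ x, x = x₁₆ + φ⟦1, 2, 3⟧ := ⟨_, rfl⟩
  obtain ⟨x₁₅, h₁₅⟩ : ∃ x, x = (φ⟦0, 2, 5⟧ * τ₁ - τ₀ * φ⟦1, 2, 4⟧ - τ₂ * φ⟦0, 1, 6⟧)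
    / (2 * τ₀ * τ₂) := ⟨_, rfl⟩
  obtain ⟨x₀₄, h₀₄⟩ : ∃ x, x = (φ⟦0, 1, 6⟧ + τ₀ * x₁₅) / τ₁ := ⟨_, rfl⟩
  obtain ⟨x₂₆, h₂₆⟩ : ∃ x, x = (φ⟦1, 2, 4⟧ + τ₂ * x₁₅) / τ₁ := ⟨_, rfl⟩
  obtain ⟨φ', hφ', h'⟩ := hS.exists_frame hφ
    ![bv 0 + x₀₃ • bv 3 + x₀₄ • bv 4 + x₀₅ • bv 5 + x₀₆ • bv 6,
      bv 1 + x₁₃ • bv 3 + x₁₄ • bv 4 + x₁₅ • bv 5 + x₁₆ • bv 6,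
      bv 2 + x₂₃ • bv 3 + x₂₄ • bv 4 + x₂₅ • bv 5 + x₂₆ • bv 6, bv 3, bv 4, bv 5, bv 6]
    ![bv 0 + (-x₀₃) • bv 3 + (-x₀₄) • bv 4 + (-x₀₅) • bv 5 + (-x₀₆) • bv 6,
      bv 1 + (-x₁₃) • bv 3 + (-x₁₄) • bv 4 + (-x₁₅) • bv 5 + (-x₁₆) • bv 6,
      bv 2 + (-x₂₃) • bv 3 + (-x₂₄) • bv 4 + (-x₂₅) • bv 5 + (-x₂₆) • bv 6,
      bv 3, bv 4, bv 5, bv 6]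
    (by
      ext i j
      fin_cases i <;> fin_cases j <;>
        simp [Matrix.mul_apply, Fin.sum_univ_seven, bv_apply])
  have hz : φ'⟦0, 1, 3⟧ = 0 ∧ φ'⟦0, 1, 4⟧ = 0 ∧ φ'⟦0, 1, 5⟧ = 0 ∧ φ'⟦0, 1, 6⟧ = 0 ∧
      φ'⟦0, 2, 3⟧ = 0 ∧ φ'⟦0, 2, 4⟧ = 0 ∧ φ'⟦0, 2, 5⟧ = 0 ∧ φ'⟦0, 2, 6⟧ = 0 ∧
      φ'⟦1, 2, 3⟧ = 0 ∧ φ'⟦1, 2, 4⟧ = 0 ∧ φ'⟦1, 2, 5⟧ = 0 ∧ φ'⟦1, 2, 6⟧ = 0 := by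
    refine ⟨?_, ?_, ?_, ?_, ?_, ?_, ?_, ?_, ?_, ?_, ?_, ?_⟩ <;>
      simp [h', hp, h₀, e₀, e₁, e₂] <;>
      simp only [h₀₃, h₀₄, h₀₅, h₁₃, h₂₃, h₂₄, h₂₅, h₂₆, h₀₆, h₁₄, h₁₆, h₁₅] <;>
      field_simp <;> ring
  have hp' : IsPaired φ' := by simp [IsPaired, h', hp]
  have h₀' : (φ'⟦0, 5, 6⟧ = τ₀ ∧ φ'⟦1, 4, 6⟧ = τ₁ ∧ φ'⟦2, 4, 5⟧ = τ₂) ∧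
      φ'⟦0, 4, 6⟧ = 0 ∧ φ'⟦0, 4, 5⟧ = 0 ∧ φ'⟦1, 5, 6⟧ = 0 ∧ φ'⟦2, 5, 6⟧ = 0 ∧
      φ'⟦1, 4, 5⟧ = 0 ∧ φ'⟦2, 4, 6⟧ = 0 := by
    simp [h', hp, h₀, e₀, e₁, e₂]
  rw [IsPaired] at hp'
  obtain ⟨t, ht, ht'⟩ := hS.exists_perturb hφ' (eee 0 1 2)
    (Polynomial.X_add_C_ne_zero (φ'⟦0, 1, 2⟧))
  refine ⟨t + φ'⟦0, 1, 2⟧, τ₀, τ₁, τ₂, by simpa using ht', hne₀, hne₁, hne₂, ?_⟩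
  convert ht using 1
  refine threeForm_ext (forall_increasing _ ?_)
  simp [normalForm, hz, hp', h₀', add_comm]

set_option maxHeartbeats 1000000 in
lemma normalForm_scale_mem {S : Set ThreeForm} (hS : IsOpenInvariant S) {a t₀ t₁ t₂ : ℝ}
    (h : normalForm a t₀ t₁ t₂ ∈ S) {p₀ p₁ p₂ s : ℝ} (h₀ : p₀ ≠ 0) (h₁ : p₁ ≠ 0) (h₂ : p₂ ≠ 0)
    (hs : s ≠ 0) (ha : a * (p₀ * p₁ * p₂) = 1) :
    normalForm 1 (a * t₀ * (p₀ / s) ^ 2) (a * t₁ * (p₁ / s) ^ 2) (a * t₂ * (p₂ / s) ^ 2) ∈ S := by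
  obtain ⟨φ, hφ, h'⟩ := hS.exists_frame h
    ![p₀ • bv 0, p₁ • bv 1, p₂ • bv 2, s • bv 3, (s * p₀)⁻¹ • bv 4, (s * p₁)⁻¹ • bv 5,
      (s * p₂)⁻¹ • bv 6]
    ![p₀⁻¹ • bv 0, p₁⁻¹ • bv 1, p₂⁻¹ • bv 2, s⁻¹ • bv 3, (s * p₀) • bv 4, (s * p₁) • bv 5,
      (s * p₂) • bv 6]
    (by
      ext i j
      fin_cases i <;> fin_cases j <;>
        simp [Matrix.mul_apply, bv_apply, h₀, h₁, h₂, hs] <;> field_simp)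
  have ha' : a = (p₀ * p₁ * p₂)⁻¹ := eq_inv_of_mul_eq_one_left ha
  convert hφ using 1
  refine threeForm_ext (forall_increasing _ ?_)
  simp [normalForm, h', ha']
  refine ⟨?_, ?_, ?_, ?_, ?_, ?_, ?_⟩ <;> field_simp

lemma exists_normalForm_sq_eq_one {S : Set ThreeForm} (hS : IsOpenInvariant S)
    (hne : S.Nonempty) :
    ∃ ε₀ ε₁ ε₂ : ℝ, ε₀ ^ 2 = 1 ∧ ε₁ ^ 2 = 1 ∧ ε₂ ^ 2 = 1 ∧ normalForm 1 ε₀ ε₁ ε₂ ∈ S := by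
  obtain ⟨a, t₀, t₁, t₂, ha, h₀, h₁, h₂, h⟩ := exists_normalForm hS hne
  have hsqrt : ∀ t : ℝ, t ≠ 0 → ∃ q : ℝ, 0 < q ∧ (q ^ 2) ^ 2 = (a * t) ^ 2 := fun t ht =>
    ⟨√|a * t|, Real.sqrt_pos.mpr (abs_pos.mpr (mul_ne_zero ha ht)), by
      rw [Real.sq_sqrt (abs_nonneg _), sq_abs]⟩
  obtain ⟨q₀, hq₀, e₀⟩ := hsqrt t₀ h₀
  obtain ⟨q₁, hq₁, e₁⟩ := hsqrt t₁ h₁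
  obtain ⟨q₂, hq₂, e₂⟩ := hsqrt t₂ h₂
  obtain ⟨s, hs⟩ : ∃ s : ℝ, s ^ 3 = q₀ * q₁ * q₂ / a := by
    obtain ⟨r, hr⟩ : ∃ r : ℝ, r ^ 3 = |q₀ * q₁ * q₂ / a| :=
      ⟨_, Real.rpow_inv_natCast_pow (abs_nonneg _) three_ne_zero⟩
    rcases abs_choice (q₀ * q₁ * q₂ / a) with h | h
    · exact ⟨r, hr.trans h⟩
    · exact ⟨-r, by rw [Odd.neg_pow (by decide), hr, h, neg_neg]⟩
  have hs0 : s ≠ 0 := by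
    rintro rfl
    have : q₀ * q₁ * q₂ / a ≠ 0 := by positivity
    exact this (by rw [← hs]; norm_num)
  have hsq : ∀ t q : ℝ, 0 < q → (q ^ 2) ^ 2 = (a * t) ^ 2 →
      (a * t * (s / q / s) ^ 2) ^ 2 = 1 := by
    intro t q hq e
    rw [mul_pow, ← e]
    field_simp
  refine ⟨_, _, _, hsq _ _ hq₀ e₀, hsq _ _ hq₁ e₁, hsq _ _ hq₂ e₂,
    normalForm_scale_mem hS h (by positivity) (by positivity) (by positivity) hs0 ?_⟩
  calc a * (s / q₀ * (s / q₁) * (s / q₂)) = a * s ^ 3 / (q₀ * q₁ * q₂) := by field_simp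
    _ = 1 := by rw [hs]; field_simp

/-- Invariance under signed permutations of the standard frame. -/
lemma IsOpenInvariant.mem_of_signed_perm {S : Set ThreeForm} (hS : IsOpenInvariant S)
    {φ ψ : ThreeForm} (hφ : φ ∈ S) (σ : Fin 7 → Fin 7) (s : Fin 7 → ℝ)
    (hσ : Function.Injective σ) (hs : ∀ i, s i * s i = 1)
    (h : ∀ i j k, i < j → j < k → ψ⟦i, j, k⟧ = s i * (s j * (s k * φ⟦σ i, σ j, σ k⟧))) :
    ψ ∈ S := by
  obtain ⟨φ', hφ', h'⟩ := hS.exists_frame hφ (fun i => s i • bv (σ i))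
    (fun k j => s j * bv (σ j) k) (by
      ext i j
      by_cases hij : i = j
      · simp [Matrix.mul_apply, bv_apply, hij, hs, Matrix.one_apply]
      · simp [Matrix.mul_apply, bv_apply, hij, hσ.eq_iff, Ne.symm hij])
  convert hφ' using 1
  refine threeForm_ext fun i j k hij hjk => ?_
  rw [h i j k hij hjk, h']
  simp only [tri_smul_left, tri_smul_mid, tri_smul_right]
  ring

/-- The contraction of `φ` with some nonzero decomposable bivector vanishes. -/
def HasNullPlane (φ : ThreeForm) : Prop :=
  ∃ u w, LinearIndependent ℝ ![u, w] ∧ ∀ z, tri φ u w z = 0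

lemma HasNullPlane.of_formPullback {φ : ThreeForm} (g : (Fin 7 → ℝ) ≃ₗ[ℝ] (Fin 7 → ℝ))
    (h : HasNullPlane (formPullback g.toLinearMap φ)) : HasNullPlane φ := by
  obtain ⟨u, w, hl, h⟩ := h
  refine ⟨g u, g w, ?_, fun z => ?_⟩
  · rw [LinearIndependent.pair_iff] at hl ⊢
    intro s t hst
    refine hl s t (g.injective ?_)
    simpa using hst
  · rw [← h (g.symm z)]
    simp only [tri, formPullback, AlternatingMap.compLinearMap_apply]
    congr 1
    ext i
    fin_cases i <;> simp

lemma HasNullPlane.formPullback {φ : ThreeForm} (g : (Fin 7 → ℝ) ≃ₗ[ℝ] (Fin 7 → ℝ))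
    (h : HasNullPlane φ) : HasNullPlane (formPullback g.toLinearMap φ) := by
  refine HasNullPlane.of_formPullback g.symm ?_
  convert h
  ext v
  simp [_root_.formPullback]

set_option maxHeartbeats 1000000 in
lemma omegaOne_mem_or_omegaTwo_mem {S : Set ThreeForm} (hS : IsOpenInvariant S)
    (hne : S.Nonempty) : omegaOne ∈ S ∨ omegaTwo ∈ S := by
  obtain ⟨ε₀, ε₁, ε₂, h₀, h₁, h₂, h⟩ := exists_normalForm_sq_eq_one hS hne
  rcases sq_eq_one_iff.mp h₀ with rfl | rfl <;>
    rcases sq_eq_one_iff.mp h₁ with rfl | rfl <;>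
    rcases sq_eq_one_iff.mp h₂ with rfl | rfl
  · exact .inl (hS.mem_of_signed_perm h ![1, 3, 5, 6, 4, 2, 0] (fun _ => 1) (by decide) (by simp)
      (forall_increasing _ (by simp [normalForm, omegaOne])))
  · exact .inl (hS.mem_of_signed_perm h ![0, 5, 6, 3, 4, 1, 2] ![1, 1, 1, -1, 1, 1, 1] (by decide)
      (by simp [Fin.forall_fin_succ])
      (forall_increasing _ (by simp [normalForm, omegaOne])))
  · exact .inl (hS.mem_of_signed_perm h ![0, 1, 2, 3, 4, 5, 6] ![1, 1, 1, 1, -1, 1, 1] (by decide)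
      (by simp [Fin.forall_fin_succ])
      (forall_increasing _ (by simp [normalForm, omegaOne])))
  · exact .inl (hS.mem_of_signed_perm h ![3, 6, 2, 0, 4, 5, 1] (fun _ => 1) (by decide) (by simp)
      (forall_increasing _ (by simp [normalForm, omegaOne])))
  · exact .inl (hS.mem_of_signed_perm h ![4, 5, 2, 3, 0, 1, 6] ![1, 1, 1, 1, 1, -1, 1] (by decide)
      (by simp [Fin.forall_fin_succ])
      (forall_increasing _ (by simp [normalForm, omegaOne])))
  · exact .inr (hS.mem_of_signed_perm h ![0, 1, 2, 3, 4, 5, 6] (fun _ => 1) (by decide) (by simp)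
      (forall_increasing _ (by simp [normalForm, omegaTwo])))
  · exact .inl (hS.mem_of_signed_perm h ![0, 3, 4, 1, 2, 5, 6] ![-1, -1, 1, 1, 1, 1, 1] (by decide)
      (by simp [Fin.forall_fin_succ])
      (forall_increasing _ (by simp [normalForm, omegaOne])))
  · exact .inl (hS.mem_of_signed_perm h ![4, 1, 6, 3, 0, 5, 2] ![1, 1, 1, 1, 1, 1, -1] (by decide)
      (by simp [Fin.forall_fin_succ])
      (forall_increasing _ (by simp [normalForm, omegaOne])))

lemma hasNullPlane_omegaOne : HasNullPlane omegaOne := by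
  refine ⟨bv 0 + bv 3, bv 1 - bv 6, ?_, fun z => ?_⟩
  · rw [LinearIndependent.pair_iff]
    intro s t h
    exact ⟨by simpa [bv_apply] using congrFun h 0, by simpa [bv_apply] using congrFun h 1⟩
  · simp [omegaOne, tri_eee_apply, bv_apply, Matrix.det_fin_three]
    try ring

/-- Lagrange's identity for the cross product on `ℝ⁷`. -/
lemma sum_sq_tri_omegaTwo (u w : Fin 7 → ℝ) :
    2 * ∑ k, tri omegaTwo u w (bv k) ^ 2 = ∑ i, ∑ j, (u i * w j - u j * w i) ^ 2 := by
  simp [Fin.sum_univ_seven, omegaTwo, tri_eee_apply, bv_apply, Matrix.det_fin_three]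
  ring

lemma not_hasNullPlane_omegaTwo : ¬ HasNullPlane omegaTwo := by
  rintro ⟨u, w, hl, h⟩
  have hs := sum_sq_tri_omegaTwo u w
  simp only [h, ne_eq, OfNat.ofNat_ne_zero, not_false_eq_true, zero_pow, Finset.sum_const_zero,
    mul_zero] at hs
  have huw : ∀ i j, u i * w j - u j * w i = 0 := by
    intro i j
    rw [eq_comm, Finset.sum_eq_zero_iff_of_nonneg
      fun i _ => Finset.sum_nonneg fun j _ => sq_nonneg _] at hs
    have hi := hs i (Finset.mem_univ i)
    rw [Finset.sum_eq_zero_iff_of_nonneg fun j _ => sq_nonneg _] at hi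
    exact pow_eq_zero_iff two_ne_zero |>.mp (hi j (Finset.mem_univ j))
  obtain ⟨j, hj⟩ := Function.ne_iff.mp (hl.ne_zero 1)
  refine hj ((LinearIndependent.pair_iff.mp hl (w j) (-u j) ?_).1)
  ext i
  simpa [mul_comm, sub_eq_add_neg] using huw i j

/-- Every stable 3-form on `ℝ⁷` is equivalent to exactly one of `ω₁`, `ω₂`. -/
theorem stable_three_form_dim_seven_classification (γ : (Fin 7 → ℝ) [⋀^Fin 3]→ₗ[ℝ] ℝ)
    (hγ : IsStableForm γ) :
    Xor' (∃ g : (Fin 7 → ℝ) ≃ₗ[ℝ] (Fin 7 → ℝ), formPullback g.toLinearMap γ = omegaOne)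
         (∃ g : (Fin 7 → ℝ) ≃ₗ[ℝ] (Fin 7 → ℝ), formPullback g.toLinearMap γ = omegaTwo) := by
  refine (xor_iff_or_and_not_and _ _).mpr ?_
  have hS : IsOpenInvariant {φ : ThreeForm |
      ∃ g : (Fin 7 → ℝ) ≃ₗ[ℝ] (Fin 7 → ℝ), φ = formPullback g.toLinearMap γ} := by
    refine ⟨hγ, ?_⟩
    rintro φ ⟨g, rfl⟩ h
    exact ⟨h.trans g, rfl⟩
  constructor
  · rcases omegaOne_mem_or_omegaTwo_mem hS ⟨γ, .refl _ _, rfl⟩ with ⟨g, h⟩ | ⟨g, h⟩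
    · exact .inl ⟨g, h.symm⟩
    · exact .inr ⟨g, h.symm⟩
  · rintro ⟨⟨g, hg⟩, h, hh⟩
    have h₁ : HasNullPlane γ := .of_formPullback g (hg ▸ hasNullPlane_omegaOne)
    exact not_hasNullPlane_omegaTwo (hh ▸ h₁.formPullback h)
end
end
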